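/- arXiv:2511.22255 — 4 statements merged into one kernel-verified Lean document; each statement's English description precedes it below -/
import Mathlib

section
/- The function F : (0,∞) → ℝ defined by F(α) := ∫₀¹ [ (1/(1−u²))·( Σ_{n=1}^∞ α³ n² u^{2nα} − u²(1+u²)/(1−u²)³ ) − (1/4)·(1/(1−u²))·( α/(1−u^{2α}) − 1/(1−u²) + (1−α)/2 ) ] du is not a rational function of α; i.e., there exist no real polynomials p, q with q not identically zero such that q(α)·F(α) = p(α) for all α > 0. -/
open MeasureTheory

/-- `F α = ∫₀¹ ( α·ĥ_{2,α}(1-u²) - (α/4)·ĥ_{0,α}(1-u²) ) du`, written out explicitly. -/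
noncomputable def F (α : ℝ) : ℝ :=
  ∫ u in Set.Ioo (0:ℝ) 1,
    ((1/(1-u^2)) * ((∑' n : ℕ, α^3 * (n:ℝ)^2 * u ^ (2*(n:ℝ)*α)) - u^2*(1+u^2)/(1-u^2)^3)
      - (1/4) * (1/(1-u^2)) * (α/(1-u ^ (2*α)) - 1/(1-u^2) + (1-α)/2))

open Real Set

lemma geo2 (x : ℝ) (h0 : 0 < x) (h1 : x < 1) :
    ∑' n : ℕ, (n:ℝ)^2 * x^n = x*(1+x)/(1-x)^3 := by
  have hx : ‖x‖ < 1 := by rw [Real.norm_eq_abs, abs_of_pos h0]; exact h1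
  have a2 := hasSum_choose_mul_geometric_of_norm_lt_one 2 hx
  have a1 := hasSum_choose_mul_geometric_of_norm_lt_one 1 hx
  have a0 := hasSum_choose_mul_geometric_of_norm_lt_one 0 hx
  have := ((a2.mul_left 2).sub (a1.mul_left 3)).add a0
  have h1x : (1 - x) ≠ 0 := by linarith
  have e : ∀ n : ℕ, (2 * (((n+2).choose 2 : ℕ) * x^n) - 3 * (((n+1).choose 1 : ℕ) * x^n) + ((n+0).choose 0 : ℕ) * x^n : ℝ) = (n:ℝ)^2 * x^n := by
    intro n
    rw [Nat.cast_choose_two]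
    push_cast
    simp
    ring
  simp_rw [e] at this
  rw [this.tsum_eq]
  field_simp
  ring

lemma sub1 (t : ℝ) : cosh t - 1 ≤ t * sinh t := by
  have h1 := Real.add_one_le_exp t
  have h2 := Real.add_one_le_exp (-t)
  have h3 : exp t * exp (-t) = 1 := by rw [← Real.exp_add]; simp
  rw [Real.cosh_eq, Real.sinh_eq]
  nlinarith [exp_pos t, exp_pos (-t), mul_le_mul_of_nonneg_left h2 (exp_pos t).le, mul_le_mul_of_nonneg_left h1 (exp_pos (-t)).le]

lemma sinh_le (t : ℝ) (ht : 0 ≤ t) : sinh t ≤ t * cosh t := by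
  have hm : MonotoneOn (fun x => x * cosh x - sinh x) (Ici 0) := by
    apply monotoneOn_of_deriv_nonneg (convex_Ici 0)
    · fun_prop
    · fun_prop
    · intro x hx
      simp at hx
      have : HasDerivAt (fun x => x * cosh x - sinh x) (1 * cosh x + x * sinh x - cosh x) x :=
        ((hasDerivAt_id x).mul (hasDerivAt_cosh x)).sub (hasDerivAt_sinh x)
      rw [this.deriv]
      have := Real.sinh_nonneg_iff.2 hx.le
      nlinarith [mul_nonneg hx.le this]
  have := hm (mem_Ici.2 le_rfl) (mem_Ici.2 ht) ht
  simp at this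
  linarith

noncomputable def ps (s : ℝ) : ℝ := cosh s / sinh s ^ 3 - 1 / s^3
noncomputable def Lf (s : ℝ) : ℝ := cosh s / sinh s - 1 / s

lemma Lf_nonneg (s : ℝ) (h : 0 < s) : 0 ≤ Lf s := by
  have hs : 0 < sinh s := Real.sinh_pos_iff.2 h
  unfold Lf
  rw [sub_nonneg, div_le_div_iff₀ h hs]
  linarith [sinh_le s h.le]

lemma Lf_le_self (s : ℝ) (h : 0 < s) : Lf s ≤ s := by
  have hs : 0 < sinh s := Real.sinh_pos_iff.2 h
  have h2 := Real.self_le_sinh_iff.2 h.le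
  unfold Lf
  rw [div_sub_div _ _ hs.ne' h.ne', div_le_iff₀ (by positivity)]
  nlinarith [sub1 s]

lemma Lf_le_one (s : ℝ) (h : 0 < s) : Lf s ≤ 1 := by
  have hs : 0 < sinh s := Real.sinh_pos_iff.2 h
  have h2 := Real.self_le_sinh_iff.2 h.le
  have h3 : cosh s - sinh s = exp (-s) := Real.cosh_sub_sinh s
  have h4 : exp (-s) ≤ 1 := by simp [h.le]
  unfold Lf
  rw [div_sub_div _ _ hs.ne' h.ne', div_le_iff₀ (by positivity)]
  nlinarith

lemma Lf_ge (s : ℝ) (h : 2 ≤ s) : 1/2 ≤ Lf s := by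
  have hs : 0 < sinh s := Real.sinh_pos_iff.2 (by linarith)
  have h3 : cosh s - sinh s = exp (-s) := Real.cosh_sub_sinh s
  have : 1 ≤ cosh s / sinh s := by rw [le_div_iff₀ hs]; linarith [exp_pos (-s)]
  have : 1 / s ≤ 1/2 := by gcongr
  unfold Lf; linarith

lemma Lf_le_sqrt (s : ℝ) (h : 0 < s) : Lf s ≤ √s := by
  rcases le_total s 1 with h1 | h1
  · refine (Lf_le_self s h).trans ?_
    apply Real.le_sqrt_of_sq_le; nlinarith
  · refine (Lf_le_one s h).trans ?_
    rw [Real.one_le_sqrt]; exact h1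

lemma inv_sinh_le (t : ℝ) (h : 0 < t) : 1 / sinh t ≤ 1 / t :=
  one_div_le_one_div_of_le h (Real.self_le_sinh_iff.2 h.le)

lemma inv_sub (t : ℝ) (h : 0 < t) : 1 / t - 1 / sinh t ≤ t := by
  have hs : 0 < sinh t := Real.sinh_pos_iff.2 h
  rw [div_sub_div _ _ h.ne' hs.ne', div_le_iff₀ (by positivity)]
  nlinarith [sub1 t, sinh_le t h.le]

lemma inv_sinh_exp (t : ℝ) (h : 0 < t) : 1 / sinh t ≤ exp (-t) * (1/t + 2) := by
  have hs : 0 < sinh t := Real.sinh_pos_iff.2 h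
  have h1 := Real.add_one_le_exp (2*t)
  have h3 : exp t = exp (2*t) * exp (-t) := by rw [← Real.exp_add]; ring_nf
  have h4 : exp (-t) * exp (-t) * exp (2*t) = 1 := by rw [← Real.exp_add, ← Real.exp_add]; ring_nf; simp
  have : exp (-t) * (1/t+2) = exp (-t) * (1 + 2 * t)/t := by field_simp
  rw [this, div_le_div_iff₀ hs h, Real.sinh_eq, h3]
  nlinarith [exp_pos (-t), mul_pos (exp_pos (-t)) (exp_pos (-t))]

lemma ps_small : ∃ C, 0 ≤ C ∧ ∀ s, 0 < s → s ≤ 1 → |ps s| ≤ C * s := by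
  refine ⟨10, by norm_num, ?_⟩
  intro s h0 h1
  have hs : 0 < sinh s := Real.sinh_pos_iff.2 h0
  have b1 := abs_le.1 (Real.exp_bound (x := s) (by rw [abs_of_pos h0]; exact h1) (n := 5) (by norm_num))
  have b2 := abs_le.1 (Real.exp_bound (x := -s) (by rw [abs_neg, abs_of_pos h0]; exact h1) (n := 5) (by norm_num))
  rw [abs_neg, abs_of_pos h0] at b2
  rw [abs_of_pos h0] at b1
  norm_num [Finset.sum_range_succ, Nat.factorial] at b1 b2
  obtain ⟨k, hk⟩ : ∃ k, sinh s = s * k := ⟨sinh s / s, by field_simp⟩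
  have hk1 : 1 ≤ k := by
    have := Real.self_le_sinh_iff.2 h0.le
    rw [hk] at this
    nlinarith
  obtain ⟨a, ha⟩ : ∃ a, k = 1 + s^2/6 + a * s^4 := ⟨(k - 1 - s^2/6)/s^4, by field_simp; ring⟩
  obtain ⟨b, hb⟩ : ∃ b, cosh s = 1 + s^2/2 + b * s^4 := ⟨(cosh s - 1 - s^2/2)/s^4, by field_simp; ring⟩
  have ha' : |a| ≤ 1/10 := by
    have e := Real.sinh_eq s
    have : a * s^5 = sinh s - s - s^3/6 := by rw [hk, ha]; ring
    have h5 : 0 < s^5 := by positivity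
    rw [abs_le]
    constructor
    · by_contra hh
      push Not at hh
      nlinarith
    · by_contra hh
      push Not at hh
      nlinarith
  have hb' : |b| ≤ 1 := by
    have e := Real.cosh_eq s
    have : b * s^4 = cosh s - 1 - s^2/2 := by rw [hb]; ring
    have h5 : s^5 ≤ s^4 := pow_le_pow_of_le_one h0.le h1 (by norm_num)
    have h4 : 0 < s^4 := by positivity
    rw [abs_le]
    constructor
    · by_contra hh
      push Not at hh
      nlinarith
    · by_contra hh
      push Not at hh
      nlinarith
  have key : |cosh s - k^3| ≤ 10 * s^4 := by
    have e : cosh s - k^3 = s^4 * (b - (1/12 + s^2/216 + 3 * a * (1+s^2/6)^2 + 3 * a^2*s^4*(1+s^2/6) + a^3 * s^8)) := by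
      rw [hb, ha]; ring
    rw [e, abs_mul, abs_of_pos (by positivity : 0 < s^4), mul_comm]
    gcongr
    have p2 : s^2 ≤ 1 := pow_le_one₀ h0.le h1
    have p4 : s^4 ≤ 1 := pow_le_one₀ h0.le h1
    have p8 : s^8 ≤ 1 := pow_le_one₀ h0.le h1
    have t1 : |s^2/216| ≤ 1 := by rw [abs_of_pos (by positivity)]; linarith
    have q0 : |1+s^2/6| ≤ 7/6 := by rw [abs_of_pos (by positivity)]; linarith
    have q4 : |s^4| ≤ 1 := by rw [abs_of_pos (by positivity)]; linarith
    have q8 : |s^8| ≤ 1 := by rw [abs_of_pos (by positivity)]; linarith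
    have t2 : |3 * a * (1+s^2/6)^2| ≤ 1 := by
      rw [abs_mul, abs_mul, abs_pow]
      calc |3| * |a| * |1+s^2/6|^2 ≤ |3| * (1/10) * (7/6)^2 := by gcongr
        _ ≤ 1 := by norm_num
    have t3 : |3 * a^2*s^4*(1+s^2/6)| ≤ 1 := by
      rw [abs_mul, abs_mul, abs_mul, abs_pow]
      calc |3| * |a|^2 * |s^4| * |1+s^2/6| ≤ |3| * (1/10)^2 * 1 * (7/6) := by gcongr
        _ ≤ 1 := by norm_num
    have t4 : |a^3 * s^8| ≤ 1 := by
      rw [abs_mul, abs_pow]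
      calc |a|^3 * |s^8| ≤ (1/10)^3 * 1 := by gcongr
        _ ≤ 1 := by norm_num
    rw [abs_le] at *
    constructor <;> linarith
  have e : ps s = (cosh s - k^3) / (s^3 * k^3) := by
    unfold ps; rw [hk]; field_simp
  rw [e, abs_div, div_le_iff₀ (by positivity), abs_of_pos (by positivity : 0 < s^3 * k^3)]
  refine key.trans ?_
  have : 1 ≤ k^3 := one_le_pow₀ hk1
  have h4 : 0 < s^4 := by positivity
  nlinarith

lemma ps_large : ∃ C, 0 ≤ C ∧ ∀ s, 1 ≤ s → |ps s| ≤ C / s^3 := by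
  refine ⟨200, by norm_num, ?_⟩
  intro s h1
  have hs : 0 < sinh s := Real.sinh_pos_iff.2 (by linarith)
  have h0 : 0 < s := by linarith
  have hc := Real.cosh_pos s
  have e2 : exp (-s) ≤ exp s / 2 := by
    have h3 : exp s = exp (2*s) * exp (-s) := by rw [← Real.exp_add]; ring_nf
    have := Real.add_one_le_exp (2*s)
    have := exp_pos (-s)
    nlinarith
  have s1 : exp s / 4 ≤ sinh s := by rw [Real.sinh_eq]; linarith
  have c1 : cosh s ≤ 3 * sinh s := by rw [Real.sinh_eq, Real.cosh_eq]; linarith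
  have f1 := Real.pow_div_factorial_le_exp (2*s) (by linarith) 3
  have f2 : exp (2*s) = exp s ^2 := by rw [two_mul, Real.exp_add]; ring
  norm_num [Nat.factorial] at f1
  have p : cosh s / sinh s^3 ≤ 50/s^3 := by
    rw [div_le_div_iff₀ (by positivity) (by positivity)]
    have : (exp s/4)^2 ≤ sinh s^2 := by gcongr
    have : s^3 ≤ 16 * sinh s^2 := by nlinarith
    calc cosh s * s^3 ≤ (3 * sinh s) * (16 * sinh s^2) := by gcongr
      _ ≤ _ := by nlinarith [pow_pos hs 3]
  have p0 : 0 < cosh s / sinh s^3 := by positivity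
  have p1 : 0 < 1/s^3 := by positivity
  have e3 : 50 / s^3 = 50 * (1/s^3) := by ring
  have e4 : 200 / s^3 = 200 * (1/s^3) := by ring
  unfold ps
  rw [e3] at p
  rw [e4, abs_le]
  constructor <;> linarith

lemma meas_ps : Measurable ps := by unfold ps; fun_prop
lemma meas_Lf : Measurable Lf := by unfold Lf; fun_prop

lemma integ_of_bound (f : ℝ → ℝ) (hf : Measurable f) (C : ℝ)
    (h1 : ∀ s, 0 < s → s ≤ 1 → |f s| ≤ C) (h2 : ∀ s, 1 ≤ s → |f s| ≤ C / s^2) :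
    IntegrableOn f (Ioi 0) := by
  rw [← Ioc_union_Ioi_eq_Ioi (zero_le_one (α := ℝ))]
  refine IntegrableOn.union ?_ ?_
  · refine Measure.integrableOn_of_bounded (M := C) (by simp) hf.aestronglyMeasurable ?_
    filter_upwards [ae_restrict_mem measurableSet_Ioc] with x hx
    exact h1 x hx.1 hx.2
  · have := (integrableOn_Ioi_rpow_of_lt (a := -2) (c := 1) (by norm_num) (by norm_num)).const_mul C
    refine Integrable.mono' this hf.aestronglyMeasurable ?_
    filter_upwards [ae_restrict_mem measurableSet_Ioi] with x hx
    refine (h2 x (le_of_lt hx)).trans (le_of_eq ?_)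
    have hx0 : (0:ℝ) < x := lt_trans zero_lt_one hx
    rw [Real.rpow_neg hx0.le]
    norm_num
    rfl

lemma integ_ps_div : IntegrableOn (fun s => ps s / s) (Ioi 0) := by
  obtain ⟨C, hC, h1⟩ := ps_small
  obtain ⟨D, hD, h2⟩ := ps_large
  refine integ_of_bound _ (meas_ps.div measurable_id) (C + D) ?_ ?_
  · intro s h0 hs
    rw [abs_div, abs_of_pos h0, div_le_iff₀ h0]
    nlinarith [h1 s h0 hs]
  · intro s hs
    have h0 : 0 < s := by linarith
    rw [abs_div, abs_of_pos h0, div_le_iff₀ h0]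
    refine (h2 s hs).trans ?_
    rw [div_mul_eq_mul_div, div_le_div_iff₀ (by positivity) (by positivity)]
    have : s^2 ≤ s^4 := pow_le_pow_right₀ hs (by norm_num)
    have h4 : 0 < s^4 := by positivity
    nlinarith

lemma integ_ps_mul : IntegrableOn (fun s => |ps s| * s) (Ioi 0) := by
  obtain ⟨C, hC, h1⟩ := ps_small
  obtain ⟨D, hD, h2⟩ := ps_large
  refine integ_of_bound _ (meas_ps.abs.mul measurable_id) (C + D) ?_ ?_
  · intro s h0 hs
    rw [abs_mul, abs_abs, abs_of_pos h0]
    calc |ps s| * s ≤ (C * 1) * 1 := by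
          gcongr
          exact (h1 s h0 hs).trans (by gcongr)
      _ ≤ C + D := by linarith
  · intro s hs
    have h0 : 0 < s := by linarith
    rw [abs_mul, abs_abs, abs_of_pos h0]
    calc |ps s| * s ≤ (D / s^3) * s := by gcongr; exact h2 s hs
      _ = D / s^2 := by field_simp
      _ ≤ (C + D) / s^2 := by gcongr; linarith

lemma integ_ps_sinh (a : ℝ) (ha : 0 < a) : IntegrableOn (fun t => ps (a*t) / sinh t) (Ioi 0) := by
  have h := (integrableOn_Ioi_comp_mul_left_iff (fun s => ps s / s) 0 ha).2 (by simpa using integ_ps_div)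
  have h' := (h.const_mul a).norm
  refine Integrable.mono' h' (Measurable.aestronglyMeasurable ?_) ?_
  · exact (meas_ps.comp (measurable_const_mul a)).div (by fun_prop)
  · filter_upwards [ae_restrict_mem measurableSet_Ioi] with t ht
    have ht : 0 < t := ht
    have hs : 0 < sinh t := Real.sinh_pos_iff.2 ht
    have e : a * (ps (a*t) / (a*t)) = ps (a*t) * (1/t) := by field_simp
    rw [e, norm_mul, div_eq_mul_one_div, norm_mul]
    gcongr
    rw [Real.norm_eq_abs, Real.norm_eq_abs, abs_of_pos (by positivity), abs_of_pos (by positivity)]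
    exact inv_sinh_le t ht

/-- main term of the first part -/
lemma ps_main : ∃ c K : ℝ, ∀ a, 0 < a →
    |a^3 * (∫ t in Ioi (0:ℝ), ps (a*t) / sinh t) - c * a^3| ≤ K * a := by
  refine ⟨∫ s in Ioi (0:ℝ), ps s / s, ∫ s in Ioi (0:ℝ), |ps s| * s, ?_⟩
  intro a ha
  have h := (integrableOn_Ioi_comp_mul_left_iff (fun s => ps s / s) 0 ha).2 (by simpa using integ_ps_div)
  have i1 := integral_comp_mul_left_Ioi (fun s => ps s / s) 0 ha
  have i2 := integral_comp_mul_left_Ioi (fun s => |ps s| * s) 0 ha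
  have g := (integrableOn_Ioi_comp_mul_left_iff (fun s => |ps s| * s) 0 ha).2 (by simpa using integ_ps_mul)
  simp only [mul_zero, smul_eq_mul] at i1 i2
  have e1 : (∫ s in Ioi (0:ℝ), ps s / s) = ∫ t in Ioi (0:ℝ), a * (ps (a*t) / (a*t)) := by
    rw [integral_const_mul, i1]; field_simp
  have e2 : (∫ s in Ioi (0:ℝ), |ps s| * s) = a^2 * ∫ t in Ioi (0:ℝ), (|ps (a*t)| * (a*t)) / a := by
    rw [integral_div, i2]; field_simp
  rw [e1, e2, mul_comm _ (a^3), ← mul_sub, ← integral_sub (integ_ps_sinh a ha) (h.const_mul a),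
    abs_mul, abs_of_pos (by positivity), show ∀ y, a^2 * y * a = a^3 * y by intro y; ring]
  gcongr
  rw [← Real.norm_eq_abs]
  refine norm_integral_le_of_norm_le (g.div_const a) ?_
  filter_upwards [ae_restrict_mem measurableSet_Ioi] with t ht
  have ht : 0 < t := ht
  have hs : 0 < sinh t := Real.sinh_pos_iff.2 ht
  have e : ps (a*t) / sinh t - a * (ps (a*t) / (a*t)) = - (ps (a*t) * (1/t - 1/sinh t)) := by
    field_simp; ring
  have e' : |ps (a*t)| * (a*t) / a = |ps (a*t)| * t := by field_simp
  rw [e, norm_neg, norm_mul, e', Real.norm_eq_abs, Real.norm_eq_abs]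
  gcongr
  rw [abs_of_nonneg (by linarith [inv_sinh_le t ht])]
  exact inv_sub t ht

lemma integ_sqrt : IntegrableOn (fun t => √t / sinh t) (Ioi 0) := by
  have g1 := Real.GammaIntegral_convergent (s := 1/2) (by norm_num)
  have g2 := Real.GammaIntegral_convergent (s := 3/2) (by norm_num)
  refine Integrable.mono' (g1.add (g2.const_mul 2)) (Measurable.aestronglyMeasurable (by fun_prop)) ?_
  filter_upwards [ae_restrict_mem measurableSet_Ioi] with t ht
  have ht : 0 < t := ht
  have hs : 0 < sinh t := Real.sinh_pos_iff.2 ht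
  have hq : 0 < √t := Real.sqrt_pos.2 ht
  rw [Real.norm_eq_abs, abs_of_nonneg (by positivity), div_eq_mul_one_div]
  have e1 : t ^ ((1/2 : ℝ) - 1) = √t / t := by
    rw [Real.rpow_sub_one ht.ne', Real.sqrt_eq_rpow]
  have e2 : t ^ ((3/2 : ℝ) - 1) = √t := by
    rw [Real.sqrt_eq_rpow]; norm_num
  simp only [Pi.add_apply]
  rw [e1, e2]
  calc √t * (1 / sinh t) ≤ √t * (exp (-t) * (1/t+2)) := by gcongr; exact inv_sinh_exp t ht
    _ = _ := by ring

lemma Lf_sinh_le (a : ℝ) (ha : 0 < a) (t : ℝ) (ht : 0 < t) :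
    Lf (a*t) / sinh t ≤ √a * (√t / sinh t) := by
  have hs : 0 < sinh t := Real.sinh_pos_iff.2 ht
  rw [← mul_div_assoc, ← Real.sqrt_mul ha.le]
  gcongr
  exact Lf_le_sqrt _ (by positivity)

lemma Lf_sinh_nonneg (a : ℝ) (ha : 0 < a) (t : ℝ) (ht : 0 < t) :
    0 ≤ Lf (a*t) / sinh t := by
  have hs : 0 < sinh t := Real.sinh_pos_iff.2 ht
  exact div_nonneg (Lf_nonneg _ (by positivity)) hs.le

lemma integ_Lf (a : ℝ) (ha : 0 < a) : IntegrableOn (fun t => Lf (a*t) / sinh t) (Ioi 0) := by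
  refine Integrable.mono' (integ_sqrt.const_mul (√a)) (Measurable.aestronglyMeasurable ?_) ?_
  · exact (meas_Lf.comp (measurable_const_mul a)).div (by fun_prop)
  · filter_upwards [ae_restrict_mem measurableSet_Ioi] with t ht
    rw [Real.norm_eq_abs, abs_of_nonneg (Lf_sinh_nonneg a ha t ht)]
    exact Lf_sinh_le a ha t ht

lemma Lf_int_upper : ∃ K : ℝ, ∀ a, 0 < a → ∫ t in Ioi (0:ℝ), Lf (a*t) / sinh t ≤ K * √a := by
  refine ⟨∫ t in Ioi (0:ℝ), √t / sinh t, ?_⟩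
  intro a ha
  rw [mul_comm, ← integral_const_mul]
  exact setIntegral_mono_on (integ_Lf a ha) (integ_sqrt.const_mul _) measurableSet_Ioi
    (fun t ht => Lf_sinh_le a ha t ht)

lemma Lf_int_nonneg (a : ℝ) (ha : 0 < a) : 0 ≤ ∫ t in Ioi (0:ℝ), Lf (a*t) / sinh t :=
  setIntegral_nonneg measurableSet_Ioi (fun t ht => Lf_sinh_nonneg a ha t ht)

lemma Lf_int_lower (a : ℝ) (ha : 2 ≤ a) :
    log (a/2) / 4 ≤ ∫ t in Ioi (0:ℝ), Lf (a*t) / sinh t := by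
  have ha0 : 0 < a := by linarith
  have hsub : Ioc (2/a) 1 ⊆ Ioi (0:ℝ) := fun t ht => lt_trans (by positivity) ht.1
  have hle : 2/a ≤ 1 := by rw [div_le_one ha0]; exact ha
  have hi : IntegrableOn (fun t : ℝ => (1/4) * (1/t)) (Ioc (2/a) 1) := by
    refine (ContinuousOn.integrableOn_Icc ?_).mono_set Ioc_subset_Icc_self
    refine ContinuousOn.mul continuousOn_const (ContinuousOn.div continuousOn_const continuousOn_id ?_)
    intro t ht
    have h2a : 0 < 2/a := by positivity
    exact (lt_of_lt_of_le h2a ht.1).ne'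
  calc log (a/2)/4 = ∫ t in Ioc (2/a) 1, (1/4) * (1/t) := by
        rw [← intervalIntegral.integral_of_le hle, intervalIntegral.integral_const_mul,
          integral_one_div_of_pos (by positivity) (by norm_num), one_div_div]
        ring
    _ ≤ ∫ t in Ioc (2/a) 1, Lf (a*t) / sinh t := by
        refine setIntegral_mono_on hi ((integ_Lf a ha0).mono_set hsub) measurableSet_Ioc ?_
        intro t ht
        have ht0 : 0 < t := hsub ht
        have hs : 0 < sinh t := Real.sinh_pos_iff.2 ht0
        have l1 : 1/2 ≤ Lf (a*t) := by
          apply Lf_ge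
          have := ht.1
          rw [div_lt_iff₀ ha0] at this
          linarith
        have l2 : sinh t ≤ 2 * t := by
          have c2 : cosh t ≤ 2 := by
            have h1 : cosh t ≤ cosh 1 := by
              rw [Real.cosh_le_cosh, abs_of_pos ht0]; simpa using ht.2
            have h2 : cosh 1 ≤ 2 := by
              rw [Real.cosh_eq]
              have := Real.exp_one_lt_d9
              have : exp (-1) ≤ 1 := by simp
              linarith
            linarith
          nlinarith [sinh_le t ht0.le]
        rw [one_div_mul_one_div, div_le_div_iff₀ (by positivity) hs]
        nlinarith
    _ ≤ _ := setIntegral_mono_set (integ_Lf a ha0)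
        (by filter_upwards [ae_restrict_mem measurableSet_Ioi] with t ht using Lf_sinh_nonneg a ha0 t ht)
        hsub.eventuallyLE

lemma cosh_exp (s : ℝ) (h : 0 < s) : cosh s / sinh s = 2 / (1 - exp (-(2*s))) - 1 := by
  have h3 : exp (-(2*s)) = exp (-s) ^ 2 := by rw [← Real.exp_nat_mul]; ring_nf
  have h4 : exp s = (exp (-s))⁻¹ := by rw [Real.exp_neg, inv_inv]
  have h5 : exp (-s) < 1 := by simpa using h
  have h6 := exp_pos (-s)
  rw [h3, Real.cosh_eq, Real.sinh_eq, h4]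
  set y := exp (-s)
  have : 1 - y^2 ≠ 0 := by nlinarith
  have : y⁻¹ - y ≠ 0 := by
    have : 1 < y⁻¹ := (one_lt_inv₀ h6).2 h5
    linarith
  field_simp
  ring

lemma phi_exp (s : ℝ) (h : 0 < s) : cosh s / sinh s ^ 3 =
    4 * (exp (-(2*s)) * (1 + exp (-(2*s))) / (1 - exp (-(2*s)))^3) := by
  have h3 : exp (-(2*s)) = exp (-s) ^ 2 := by rw [← Real.exp_nat_mul]; ring_nf
  have h4 : exp s = (exp (-s))⁻¹ := by rw [Real.exp_neg, inv_inv]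
  have h5 : exp (-s) < 1 := by simpa using h
  have h6 := exp_pos (-s)
  rw [h3, Real.cosh_eq, Real.sinh_eq, h4]
  set y := exp (-s)
  have h7 : 1 - y^2 ≠ 0 := by nlinarith
  have e : y⁻¹ - y = (1 - y^2)/y := by field_simp
  rw [e]
  field_simp
  ring

lemma F_eq (a : ℝ) (ha : 0 < a) : F a =
    1/8 * (a^3 * (∫ t in Ioi (0:ℝ), ps (a*t) / sinh t) - ∫ t in Ioi (0:ℝ), ps (1*t) / sinh t)
    - 1/16 * (a * (∫ t in Ioi (0:ℝ), Lf (a*t) / sinh t) - ∫ t in Ioi (0:ℝ), Lf (1*t) / sinh t) := by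
  have him : (fun t : ℝ => exp (-t)) '' Ioi 0 = Ioo 0 1 := by
    ext u
    constructor
    · rintro ⟨t, ht, rfl⟩
      exact ⟨exp_pos _, by simpa using ht⟩
    · rintro ⟨h0, h1⟩
      exact ⟨-log u, by simpa using Real.log_neg h0 h1, by simp [Real.exp_log h0]⟩
  unfold F
  rw [← him, integral_image_eq_integral_abs_deriv_smul (f' := fun t => -exp (-t)) measurableSet_Ioi]
  rotate_left
  · intro t _
    have := (hasDerivAt_neg t).exp
    simpa using this.hasDerivWithinAt
  · intro x _ y _ hxy
    simpa using hxy
  rw [← integral_const_mul, ← integral_const_mul,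
    ← integral_sub ((integ_ps_sinh a ha).const_mul _) (integ_ps_sinh 1 one_pos),
    ← integral_sub ((integ_Lf a ha).const_mul _) (integ_Lf 1 one_pos),
    ← integral_const_mul, ← integral_const_mul, ← integral_sub]
  rotate_left
  · exact (((integ_ps_sinh a ha).const_mul _).sub (integ_ps_sinh 1 one_pos)).const_mul _
  · exact (((integ_Lf a ha).const_mul _).sub (integ_Lf 1 one_pos)).const_mul _
  refine setIntegral_congr_fun measurableSet_Ioi ?_
  intro t ht
  have ht : 0 < t := ht
  have hs : 0 < sinh t := Real.sinh_pos_iff.2 ht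
  have hat : 0 < a * t := by positivity
  have u2 : exp (-t) ^ 2 = exp (-(2*t)) := by rw [← Real.exp_nat_mul]; ring_nf
  have ua : exp (-t) ^ (2*a) = exp (-(2*(a*t))) := by rw [← Real.exp_mul]; ring_nf
  have hX1 : exp (-(2*(a*t))) < 1 := by simpa using hat
  have ts : (∑' n : ℕ, a^3 * (n:ℝ)^2 * exp (-t) ^ (2*(n:ℝ)*a)) =
      a^3 * (exp (-(2*(a*t))) * (1 + exp (-(2*(a*t)))) / (1 - exp (-(2*(a*t))))^3) := by
    rw [← geo2 _ (exp_pos _) hX1, ← tsum_mul_left]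
    congr 1
    ext n
    rw [← Real.exp_mul, ← Real.exp_nat_mul]
    ring_nf
  have si : exp (-t) * (1 / (1 - exp (-(2*t)))) = 1 / (2 * sinh t) := by
    have h4 : exp t = (exp (-t))⁻¹ := by rw [Real.exp_neg, inv_inv]
    have h5 : exp (-t) < 1 := by simpa using ht
    have h6 := exp_pos (-t)
    rw [← u2, Real.sinh_eq, h4]
    set y := exp (-t)
    have h7 : 1 - y^2 ≠ 0 := by nlinarith
    have e : y⁻¹ - y = (1 - y^2)/y := by field_simp
    rw [e]
    field_simp
  have p1 := phi_exp t ht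
  have p2 := phi_exp (a*t) hat
  have c1 := cosh_exp t ht
  have c2 := cosh_exp (a*t) hat
  simp only [smul_eq_mul, abs_neg, abs_of_pos (exp_pos _)]
  rw [ts, u2, ua]
  have q1 : exp (-(2*t)) * (1 + exp (-(2*t))) / (1 - exp (-(2*t)))^3 = (ps t + 1/t^3)/4 := by
    unfold ps; linarith
  have q2 : exp (-(2*(a*t))) * (1 + exp (-(2*(a*t)))) / (1 - exp (-(2*(a*t))))^3 = (ps (a*t) + 1/(a*t)^3)/4 := by
    unfold ps; linarith
  have r1 : 1 / (1 - exp (-(2*t))) = (Lf t + 1/t + 1)/2 := by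
    unfold Lf; rw [c1]; ring
  have r2 : a / (1 - exp (-(2*(a*t)))) = a * ((Lf (a*t) + 1/(a*t) + 1)/2) := by
    unfold Lf; rw [c2]; ring
  have step : ∀ A B C : ℝ, exp (-t) * (1 / (1 - exp (-(2*t))) * A - 1/4 * (1 / (1 - exp (-(2*t)))) * B)
      = (exp (-t) * (1 / (1 - exp (-(2*t))))) * (A - 1/4 * B) := by intros; ring
  rw [step _ _ 0, si, q1, q2, r1, r2, one_mul]
  generalize ps t = P1
  generalize ps (a*t) = P2
  generalize Lf t = L1
  generalize Lf (a*t) = L2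
  field_simp
  ring

/-- `F` is not a rational function of `α` on `(0,∞)`. -/
theorem F_not_rational :
    ¬ ∃ p q : Polynomial ℝ, q ≠ 0 ∧ ∀ α : ℝ, 0 < α → q.eval α * F α = p.eval α := by
  rintro ⟨p, q, hq, hpq⟩
  obtain ⟨c, K, hK⟩ := ps_main
  obtain ⟨K2, hK2⟩ := Lf_int_upper
  set P1 := ∫ t in Ioi (0:ℝ), ps (1*t) / sinh t with hP1
  set P2 := ∫ t in Ioi (0:ℝ), Lf (1*t) / sinh t with hP2
  set r : Polynomial ℝ := p - q * (Polynomial.C (c/8) * Polynomial.X^3) with hr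
  have hR : ∀ a, 0 < a → q.eval a * (F a - c/8 * a^3) = r.eval a := by
    intro a ha
    simp only [hr, Polynomial.eval_sub, Polynomial.eval_mul, Polynomial.eval_C, Polynomial.eval_pow, Polynomial.eval_X]
    rw [← hpq a ha]; ring
  have hroot := Polynomial.eventually_atTop_not_isRoot q hq
  have nP1 := abs_le.1 (le_refl |P1|)
  have nP2 := abs_le.1 (le_refl |P2|)
  have a1 := abs_nonneg P1
  have a2 := abs_nonneg P2
  have aK := abs_nonneg K
  have aK2 := abs_nonneg K2
  have leK := le_abs_self K
  have leK2 := le_abs_self K2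
  by_cases hd : r.degree ≤ (q * Polynomial.X).degree
  · obtain ⟨M, hM0, hM⟩ := (Polynomial.isBigO_atTop_of_degree_le _ _ hd).exists_nonneg
    have hM := hM.bound
    have hlog := (Real.tendsto_log_atTop.comp (Filter.tendsto_id.atTop_div_const (two_pos (α := ℝ)))).eventually_gt_atTop
      (64 * (M + |K| + |P1| + |P2|))
    obtain ⟨a, h1, h2, h3, h4⟩ := (hM.and (hroot.and (hlog.and (Filter.eventually_ge_atTop 2)))).exists
    have ha : 0 < a := by linarith
    rw [← hR a ha] at h1
    simp only [Polynomial.eval_mul, Polynomial.eval_X, norm_mul, Real.norm_eq_abs] at h1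
    have hqa : 0 < |q.eval a| := abs_pos.2 h2
    rw [abs_of_pos ha] at h1
    have h5 : |F a - c/8*a^3| ≤ M * a := by
      by_contra hh
      push Not at hh
      nlinarith
    rw [F_eq a ha] at h5
    have h6 := Lf_int_lower a h4
    have h7 := abs_le.1 (hK a ha)
    have h5 := abs_le.1 h5
    simp only [Function.comp, id] at h3
    have h8 : a * (16 * (M + |K| + |P1| + |P2|)) ≤ a * ∫ t in Ioi (0:ℝ), Lf (a*t) / sinh t := by
      gcongr; linarith
    have m1 : |P1| ≤ a * |P1| := le_mul_of_one_le_left a1 (by linarith)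
    have m2 : |P2| ≤ a * |P2| := le_mul_of_one_le_left a2 (by linarith)
    have m3 : K * a ≤ a * |K| := by nlinarith
    have h9 : log (a/2) / 4 > 16 * (M + |K| + |P1| + |P2|) := by linarith
    have h10 : a * (16 * (M + |K| + |P1| + |P2|)) < a * ∫ t in Ioi (0:ℝ), Lf (a*t) / sinh t := by
      gcongr; linarith
    have := mul_nonneg ha.le aK
    have := mul_nonneg ha.le a1
    have := mul_nonneg ha.le a2
    linarith [h5.1, h5.2, h7.1, h7.2]
  · have hd' : (q * Polynomial.X^2).degree ≤ r.degree := by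
      push Not at hd
      have hr0 : r ≠ 0 := by
        rintro h
        simp [h] at hd
      rw [Polynomial.degree_eq_natDegree (by simp [hq]), Polynomial.degree_eq_natDegree hr0] at hd ⊢
      rw [Polynomial.natDegree_mul hq (by simp)] at hd ⊢
      simp only [Polynomial.natDegree_X, Polynomial.natDegree_X_pow] at hd ⊢
      norm_cast at hd ⊢
    obtain ⟨M, hM0, hM⟩ := (Polynomial.isBigO_atTop_of_degree_le _ _ hd').exists_nonneg
    have hM := hM.bound
    have hsq := Real.tendsto_sqrt_atTop.eventually_gt_atTop (M * (|K| + |P1| + |K2| + |P2|))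
    obtain ⟨a, h1, h2, h3, h4⟩ := (hM.and (hroot.and (hsq.and (Filter.eventually_ge_atTop 1)))).exists
    have ha : 0 < a := by linarith
    rw [← hR a ha] at h1
    simp only [Polynomial.eval_mul, Polynomial.eval_X, Polynomial.eval_pow, norm_mul, norm_pow, Real.norm_eq_abs] at h1
    have hqa : 0 < |q.eval a| := abs_pos.2 h2
    rw [abs_of_pos ha] at h1
    have h5 : a^2 ≤ M * |F a - c/8*a^3| := by
      by_contra hh
      push Not at hh
      nlinarith
    have hs1 : 1 ≤ √a := by rw [Real.one_le_sqrt]; exact h4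
    have hss : √a * √a = a := Real.mul_self_sqrt ha.le
    have h6 : |F a - c/8*a^3| ≤ (|K| + |P1| + |K2| + |P2|) * (a * √a) := by
      rw [F_eq a ha]
      have h7 := abs_le.1 (hK a ha)
      have h8 : a * (∫ t in Ioi (0:ℝ), Lf (a*t) / sinh t) ≤ |K2| * (a * √a) := by
        calc a * (∫ t in Ioi (0:ℝ), Lf (a*t) / sinh t) ≤ a * (|K2| * √a) := by
              gcongr
              exact (hK2 a ha).trans (by gcongr)
          _ = _ := by ring
      have h9 : 0 ≤ a * (∫ t in Ioi (0:ℝ), Lf (a*t) / sinh t) := mul_nonneg ha.le (Lf_int_nonneg a ha)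
      have w : a ≤ a * √a := le_mul_of_one_le_right ha.le hs1
      have w1 : 1 ≤ a * √a := by linarith
      have m1 : |P1| ≤ |P1| * (a * √a) := le_mul_of_one_le_right a1 w1
      have m2 : |P2| ≤ |P2| * (a * √a) := le_mul_of_one_le_right a2 w1
      have m3 : K * a ≤ |K| * (a * √a) := by
        calc K * a ≤ |K| * a := by gcongr
          _ ≤ _ := by gcongr
      rw [abs_le]
      constructor <;> nlinarith [h7.1, h7.2]
    have h7 : a^2 ≤ M * ((|K| + |P1| + |K2| + |P2|) * (a * √a)) :=
      h5.trans (by gcongr)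
    have h8 : M * (|K| + |P1| + |K2| + |P2|) * (a * √a) < √a * (a * √a) := by
      gcongr
    have h9 : √a * (a * √a) = a^2 := by
      calc √a * (a * √a) = a * (√a * √a) := by ring
        _ = a^2 := by rw [hss]; ring
    linarith
end

section
/- For every odd natural number j ≥ 1: V_j > (7/9) · ( 2^{j−1} · π^{j+3} · |B_{j+3}| / ( (j+3)! · (j+3) ) ) · ( (2^{j+3} − 1)/(3^{j+1} − 1) ) > 0, where V_j := −( I_j/(j!·(j+3)) − I_{j+2}/(4·(j+3)!) ). -/
/-- `I j = ∫₀¹ (log(u²))^j / (1-u²) du`. -/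
noncomputable def I (j : ℕ) : ℝ :=
  ∫ u in Set.Ioo (0:ℝ) 1, (Real.log (u^2))^j / (1 - u^2)

/-- `V j = -( I_j/(j!·(j+3)) - I_{j+2}/(4·(j+3)!) )`. -/
noncomputable def V (j : ℕ) : ℝ :=
  -(I j / ((j.factorial : ℝ) * ((j:ℝ)+3)) - I (j+2) / (4 * ((j+3).factorial : ℝ)))

open MeasureTheory Set in
lemma I_subst (j : ℕ) :
    I j = ∫ t in Ioi (0:ℝ), Real.exp (-t) * ((-2 * t)^j / (1 - Real.exp (-t)^2)) := by
  have himg : (fun t : ℝ => Real.exp (-t)) '' Ioi 0 = Ioo 0 1 := by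
    ext u
    constructor
    · rintro ⟨t, ht, rfl⟩
      have ht : 0 < t := ht
      exact ⟨Real.exp_pos _, by simpa using ht⟩
    · rintro ⟨h0, h1⟩
      refine ⟨-Real.log u, ?_, ?_⟩
      · have := Real.log_neg h0 h1
        simpa using this
      · simp [Real.exp_log h0]
  have hd : ∀ x ∈ Ioi (0:ℝ), HasDerivWithinAt (fun t : ℝ => Real.exp (-t))
      (-Real.exp (-x)) (Ioi 0) x := by
    intro x _
    have := ((hasDerivAt_id x).neg.exp).hasDerivWithinAt (s := Ioi 0)
    simpa using this
  have hinj : InjOn (fun t : ℝ => Real.exp (-t)) (Ioi 0) := by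
    intro a _ b _ h
    simpa using h
  unfold I
  rw [← himg, integral_image_eq_integral_abs_deriv_smul measurableSet_Ioi hd hinj]
  refine setIntegral_congr_fun measurableSet_Ioi (fun t _ => ?_)
  simp only [smul_eq_mul, abs_neg, Real.abs_exp, Real.log_pow, Real.log_exp]
  congr 3
  push_cast
  ring

open MeasureTheory Set in
lemma int_term (j n : ℕ) :
    IntegrableOn (fun t : ℝ => t^j * Real.exp (-((2*n+1) * t))) (Ioi 0) ∧
    ∫ t in Ioi (0:ℝ), t^j * Real.exp (-((2*n+1) * t)) = j.factorial * (1 / (2*n+1:ℝ)^(j+1)) := by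
  have hc : (0:ℝ) < 2*n+1 := by positivity
  have key := Real.integral_rpow_mul_exp_neg_mul_Ioi (a := (j:ℝ)+1) (by positivity) hc
  have e : ∀ t : ℝ, t ^ ((j:ℝ)+1-1) = t^j := by
    intro t; rw [add_sub_cancel_right, Real.rpow_natCast]
  simp only [e, Real.Gamma_nat_eq_factorial] at key
  have e2 : (1 / (2*n+1:ℝ)) ^ ((j:ℝ)+1) = 1 / (2*n+1:ℝ)^(j+1) := by
    rw [← Nat.cast_add_one, Real.rpow_natCast, one_div_pow]
  rw [e2, mul_comm (1 / _)] at key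
  refine ⟨.of_integral_ne_zero (by rw [key]; positivity), key⟩

lemma summable_odd (s : ℕ) (hs : 2 ≤ s) : Summable (fun n : ℕ => 1 / (2*n+1:ℝ)^s) := by
  have h := Real.summable_one_div_nat_pow.mpr (show 1 < s by omega)
  have h2 := h.comp_injective (i := fun n : ℕ => 2*n+1) (fun a b h => by simpa using h)
  refine h2.congr (fun n => ?_)
  simp

open MeasureTheory Set in
lemma I_eq (j : ℕ) (hj : 1 ≤ j) :
    I j = (-2)^j * j.factorial * ∑' n : ℕ, 1 / (2*n+1:ℝ)^(j+1) := by
  have hs := summable_odd (j+1) (by omega)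
  have h := hasSum_integral_of_summable_integral_norm (μ := volume.restrict (Ioi (0:ℝ)))
    (F := fun (n : ℕ) (t : ℝ) => t^j * Real.exp (-((2*n+1) * t)))
    (fun n => (int_term j n).1) (by
      refine (hs.mul_left (j.factorial : ℝ)).congr (fun n => ?_)
      rw [← (int_term j n).2]
      refine setIntegral_congr_fun measurableSet_Ioi (fun t ht => ?_)
      have ht : 0 < t := ht
      rw [Real.norm_of_nonneg (by positivity)])
  have h1 := h.tsum_eq
  simp only [(int_term j _).2] at h1
  rw [tsum_mul_left] at h1
  rw [mul_assoc, h1, I_subst, ← integral_const_mul]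
  refine setIntegral_congr_fun measurableSet_Ioi (fun t ht => ?_)
  have ht : 0 < t := ht
  have hx0 : 0 < Real.exp (-t) := Real.exp_pos _
  have hx1 : Real.exp (-t) < 1 := by simpa using ht
  have hx2 : Real.exp (-t)^2 < 1 := by nlinarith
  have hg : ∑' n : ℕ, t^j * Real.exp (-((2*n+1) * t))
      = t^j * (Real.exp (-t) * (1 - Real.exp (-t)^2)⁻¹) := by
    rw [tsum_mul_left, ← tsum_geometric_of_lt_one (by positivity) hx2,
      ← tsum_mul_left (a := Real.exp (-t))]
    congr 1
    refine tsum_congr (fun n => ?_)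
    rw [← pow_mul, ← pow_succ', ← Real.exp_nat_mul]
    congr 1
    push_cast
    ring
  simp only [hg, mul_pow]
  ring

lemma odd_zeta (s : ℕ) (hs : 2 ≤ s) :
    (2:ℝ)^s * ∑' n : ℕ, 1 / (2*n+1:ℝ)^s = (2^s - 1) * ∑' n : ℕ, 1 / (n:ℝ)^s := by
  have h := Real.summable_one_div_nat_pow.mpr (show 1 < s by omega)
  have he : Summable (fun n : ℕ => 1 / ((2*n : ℕ):ℝ)^s) :=
    h.comp_injective (i := fun n : ℕ => 2*n) (fun a b h => by simpa using h)
  have ho : Summable (fun n : ℕ => 1 / ((2*n+1 : ℕ):ℝ)^s) :=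
    h.comp_injective (i := fun n : ℕ => 2*n+1) (fun a b h => by simpa using h)
  have key := tsum_even_add_odd (f := fun n : ℕ => 1 / (n:ℝ)^s) he ho
  have e1 : ∑' n : ℕ, 1 / ((2*n : ℕ):ℝ)^s = (1/2^s) * ∑' n : ℕ, 1 / (n:ℝ)^s := by
    rw [← tsum_mul_left]
    congr 1; ext n; push_cast; rw [mul_pow, one_div_mul_one_div]
  have e2 : ∑' n : ℕ, 1 / ((2*n+1 : ℕ):ℝ)^s = ∑' n : ℕ, 1 / (2*n+1:ℝ)^s := by
    congr 1; ext n; push_cast; rfl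
  rw [e1, e2] at key
  have : (2:ℝ)^s ≠ 0 := by positivity
  generalize ∑' n : ℕ, 1 / (n:ℝ)^s = z at *
  generalize ∑' n : ℕ, 1 / (2*n+1:ℝ)^s = l at *
  rw [← key]
  have : l = z - 1/2^s*z := by linarith
  subst this
  field_simp
  ring

lemma zeta_abs (k : ℕ) (hk : k ≠ 0) :
    ∑' n : ℕ, 1 / (n:ℝ)^(2*k) = (2:ℝ)^(2*k-1) * Real.pi^(2*k) *
      |((bernoulli (2*k) : ℚ) : ℝ)| / ((2*k).factorial : ℝ) := by
  have h := (hasSum_zeta_nat hk).tsum_eq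
  have h0 : 0 ≤ ∑' n : ℕ, 1 / (n:ℝ)^(2*k) := tsum_nonneg (fun n => by positivity)
  rw [← abs_of_nonneg h0, h, abs_div, abs_mul, abs_mul, abs_mul, abs_pow, abs_neg, abs_one,
    one_pow, one_mul, abs_of_pos (show (0:ℝ) < 2^(2*k-1) by positivity),
    abs_of_pos (show (0:ℝ) < Real.pi^(2*k) by positivity), Nat.abs_cast]

lemma odd_le (s : ℕ) (hs : 4 ≤ s) : ∑' n : ℕ, 1 / (2*n+1:ℝ)^s < 64/63 := by
  have h4 := odd_zeta 4 (by norm_num)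
  rw [hasSum_zeta_four.tsum_eq] at h4
  have hle : ∑' n : ℕ, 1 / (2*n+1:ℝ)^s ≤ ∑' n : ℕ, 1 / (2*n+1:ℝ)^4 := by
    refine Summable.tsum_le_tsum (fun n => ?_) (summable_odd s (by omega))
      (summable_odd 4 (by norm_num))
    apply one_div_le_one_div_of_le (by positivity)
    exact pow_le_pow_right₀ (by linarith [(Nat.cast_nonneg n : (0:ℝ) ≤ n)]) hs
  have hpi : Real.pi^4 < 3.1416^4 :=
    pow_lt_pow_left₀ Real.pi_lt_d4 Real.pi_pos.le (by norm_num)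
  norm_num at hpi h4
  norm_num at hle
  norm_num
  linarith

lemma odd_diff (s : ℕ) (hs : 2 ≤ s) :
    8/9 * (1/3^s) ≤ ∑' n : ℕ, 1 / (2*n+1:ℝ)^s - ∑' n : ℕ, 1 / (2*n+1:ℝ)^(s+2) := by
  have h1 := summable_odd s hs
  have h2 := summable_odd (s+2) (by omega)
  rw [← h1.tsum_sub h2]
  have := (h1.sub h2).le_tsum 1 (fun n _ => by
    rw [sub_nonneg]
    apply one_div_le_one_div_of_le (by positivity)
    exact pow_le_pow_right₀ (by linarith [(Nat.cast_nonneg n : (0:ℝ) ≤ n)]) (by omega))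
  refine le_trans (le_of_eq ?_) this
  norm_num
  rw [pow_add]
  field_simp
  norm_num

lemma one_le_odd (s : ℕ) (hs : 2 ≤ s) : 1 ≤ ∑' n : ℕ, 1 / (2*n+1:ℝ)^s := by
  have := (summable_odd s hs).le_tsum 0 (fun n _ => by positivity)
  simpa using this

theorem V_lower_bound (j : ℕ) (hj : 1 ≤ j) (hodd : Odd j) :
    (7/9) * ((2:ℝ)^(j-1) * Real.pi^(j+3) * |((bernoulli (j+3) : ℚ) : ℝ)|
        / (((j+3).factorial : ℝ) * ((j:ℝ)+3)))
      * (((2:ℝ)^(j+3) - 1)/((3:ℝ)^(j+1) - 1)) < V j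
    ∧ 0 < (7/9) * ((2:ℝ)^(j-1) * Real.pi^(j+3) * |((bernoulli (j+3) : ℚ) : ℝ)|
        / (((j+3).factorial : ℝ) * ((j:ℝ)+3)))
      * (((2:ℝ)^(j+3) - 1)/((3:ℝ)^(j+1) - 1)) := by
  obtain ⟨m, rfl⟩ := hodd
  have hz := zeta_abs (m+2) (by omega)
  have hoz := odd_zeta (2*(m+2)) (by omega)
  have hI1 := I_eq (2*m+1) (by omega)
  have hI2 := I_eq (2*m+1+2) (by omega)
  have hd := odd_diff (2*m+1+1) (by omega)
  have hl := odd_le (2*m+1+2+1) (by omega)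
  have h1 := one_le_odd (2*m+1+2+1) (by omega)
  rw [hz] at hoz
  rw [show 2*m+1+1+2 = 2*m+1+2+1 by omega] at hd
  rw [show 2*(m+2) = 2*m+1+2+1 by omega] at hoz
  simp only [show 2*m+1+3 = 2*m+1+2+1 by omega]
  unfold V
  rw [hI1, hI2]
  simp only [show 2*m+1+3 = 2*m+1+2+1 by omega]
  generalize ∑' n : ℕ, 1 / (2*n+1:ℝ)^(2*m+1+2+1) = L at *
  generalize ∑' n : ℕ, 1 / (2*n+1:ℝ)^(2*m+1+1) = K at *
  generalize |((bernoulli (2*m+1+2+1) : ℚ) : ℝ)| = B at *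
  have hV : -((-2)^(2*m+1) * ((2*m+1).factorial:ℝ) * K
        / (((2*m+1).factorial:ℝ) * (((2*m+1:ℕ):ℝ)+3))
      - (-2)^(2*m+1+2) * ((2*m+1+2).factorial:ℝ) * L / (4 * ((2*m+1+2+1).factorial:ℝ)))
      = 2^(2*m+1) / (((2*m+1:ℕ):ℝ)+3) * (K - L) := by
    rw [Nat.factorial_succ (2*m+1+2)]
    have hf1 : ((2*m+1).factorial:ℝ) ≠ 0 := by positivity
    have hf2 : ((2*m+1+2).factorial:ℝ) ≠ 0 := by positivity
    have e : (-2:ℝ)^(2*m+1) = -2^(2*m+1) := Odd.neg_pow ⟨m, rfl⟩ 2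
    rw [pow_add (-2:ℝ) (2*m+1) 2, e]
    have c : (((2*m+1+2+1 : ℕ)):ℝ) = ((2*m+1:ℕ):ℝ)+3 := by push_cast; ring
    rw [Nat.cast_mul, c]
    have hc : ((2*m+1:ℕ):ℝ)+3 ≠ 0 := by positivity
    generalize ((2*m+1:ℕ):ℝ)+3 = C at *
    field_simp
    ring
  rw [hV]
  have hR : (7/9) * ((2:ℝ)^(2*m+1-1) * Real.pi^(2*m+1+2+1) * B
        / (((2*m+1+2+1).factorial : ℝ) * (((2*m+1:ℕ):ℝ)+3)))
      * (((2:ℝ)^(2*m+1+2+1) - 1)/((3:ℝ)^(2*m+1+1) - 1))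
      = 2^(2*m+1) / (((2*m+1:ℕ):ℝ)+3) * (7/9 * L / ((3:ℝ)^(2*m+1+1) - 1)) := by
    have e1 : (2:ℝ)^(2*m+1+2+1-1) = 8 * 2^(2*m+1-1) := by
      rw [show 2*m+1+2+1-1 = 3 + (2*m+1-1) by omega, pow_add]; norm_num
    have e2 : (2:ℝ)^(2*m+1+2+1) * L = 8 * 2^(2*m+1) * L := by
      rw [show 2*m+1+2+1 = 3 + (2*m+1) by omega, pow_add]; norm_num
    rw [e1, e2] at hoz
    have e3 : (2:ℝ)^(2*m+1) * L = (2^(2*m+1+2+1) - 1) * (2^(2*m+1-1) *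
        Real.pi^(2*m+1+2+1) * B / ((2*m+1+2+1).factorial:ℝ)) := by
      linear_combination hoz / 8
    have e4 : ∀ a b c d : ℝ, a / b * (7/9*c/d) = 7/9 * (a*c) / (b*d) := by
      intro a b c d; ring
    have e5 : ∀ x f b y d : ℝ, 7/9*(x/(f*b))*(y/d) = 7/9*(y*(x/f))/(b*d) := by
      intro x f b y d; ring
    rw [e4, e3, e5]
  rw [hR]
  have h9 : (9:ℝ) ≤ 3^(2*m+1+1) := by
    calc (9:ℝ) = 3^2 := by norm_num
      _ ≤ 3^(2*m+1+1) := pow_le_pow_right₀ (by norm_num) (by omega)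
  generalize (3:ℝ)^(2*m+1+1) = T at *
  have hT : 0 < T - 1 := by linarith
  constructor
  · apply mul_lt_mul_of_pos_left _ (by positivity)
    refine lt_of_lt_of_le ?_ hd
    rw [div_lt_iff₀ hT]
    have : 8/9 * (1/T) * (T-1) = 8/9 - 8/9 * (1/T) := by
      field_simp
    rw [this]
    have : 1/T ≤ 1/9 := one_div_le_one_div_of_le (by norm_num) h9
    linarith
  · positivity
end

section
/- For every α > 0 and every natural number k ≥ 0: lim_{t→0⁺} ( Σ_{n=0}^∞ α^k n^k (1−t)^{nα} − (1/α) Σ_{n=0}^∞ n^k (1−t)^n ) = B_{k+1}·(1 − α^{k+1}) / (α·(k+1)), where the limit is taken over real t ∈ (0,1) and the convention 0^0 := 1 is used for the n = 0 terms. -/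
open Filter Topology Set

lemma aux_dslope {f : ℝ → ℝ} (hf : AnalyticAt ℝ f 0) : AnalyticAt ℝ (dslope f 0) 0 := by
  obtain ⟨p, hp⟩ := hf
  exact ⟨_, hp.has_fpower_series_dslope_fslope⟩

lemma aux_leib {h : ℝ → ℝ} (hh : AnalyticAt ℝ h 0) (n : ℕ) :
    iteratedDeriv n (fun x => x * h x) 0 = n * iteratedDeriv (n-1) h 0 := by
  have := iteratedDeriv_mul (n := n) (f := fun x : ℝ => x) (g := h) (x := 0) (by fun_prop) hh.contDiffAt
  change iteratedDeriv n ((fun x : ℝ => x) * h) 0 = _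
  rw [this]
  rcases n with _ | n
  · simp
  · rw [Finset.sum_eq_single 1]
    · simp [iteratedDeriv_one]
    · intro i _ hi
      rcases i with _ | _ | i
      · simp
      · simp at hi
      · have : iteratedDeriv (i+1+1) (fun x : ℝ => x) 0 = 0 := by
          simp [iteratedDeriv_succ', iteratedDeriv_const]
        rw [this]; simp
    · simp

/-- s/(1-e^{-s}) -/
noncomputable def auxE : ℝ → ℝ := dslope (fun s => 1 - Real.exp (-s)) 0
noncomputable def auxb : ℝ → ℝ := fun s => (auxE s)⁻¹
noncomputable def auxG : ℝ → ℝ := dslope auxb 0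

lemma auxE_zero : auxE 0 = 1 := by
  have : HasDerivAt (fun s : ℝ => 1 - Real.exp (-s)) 1 0 := by
    have := ((hasDerivAt_neg (0:ℝ)).exp).const_sub 1
    simpa using this
  simp [auxE, dslope_same, this.deriv]

lemma auxb_zero : auxb 0 = 1 := by simp [auxb, auxE_zero]

lemma auxE_an : AnalyticAt ℝ auxE 0 := aux_dslope (by fun_prop)
lemma auxb_an : AnalyticAt ℝ auxb 0 := auxE_an.inv (by simp [auxE_zero])
lemma auxG_an : AnalyticAt ℝ auxG 0 := aux_dslope auxb_an

lemma auxb_ne {s : ℝ} (hs : s ≠ 0) : auxb s = s / (1 - Real.exp (-s)) := by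
  simp [auxb, auxE, dslope_of_ne _ hs, slope_def_field]

lemma auxG_ne {s : ℝ} (hs : s ≠ 0) : auxG s = 1 / (1 - Real.exp (-s)) - 1 / s := by
  rw [auxG, dslope_of_ne _ hs, slope_def_field, auxb_zero, auxb_ne hs]
  field_simp
  simp
  ring

lemma auxb_eq : auxb = fun s => 1 + s * auxG s := by
  funext s
  rcases eq_or_ne s 0 with rfl | hs
  · simp [auxb_zero]
  · rw [auxG_ne hs, auxb_ne hs]; field_simp; ring

lemma auxb_mul (s : ℝ) : auxb s * (Real.exp s - 1) = s * Real.exp s := by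
  rcases eq_or_ne s 0 with rfl | hs
  · simp
  · rw [auxb_ne hs]
    have h1 : 1 - Real.exp (-s) ≠ 0 := by
      intro h
      have : Real.exp (-s) = 1 := by linarith
      simp at this; exact hs this
    have h2 : Real.exp s - 1 = Real.exp s * (1 - Real.exp (-s)) := by
      rw [mul_sub, ← Real.exp_add]; simp
    rw [h2]; field_simp

lemma aux_sum (n : ℕ) :
    ∑ i ∈ Finset.range n, (n.choose i : ℝ) * iteratedDeriv i auxb 0 = n := by
  have h1 := iteratedDeriv_mul (n := n) (f := auxb) (g := fun s => Real.exp s - 1) (x := 0)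
    auxb_an.contDiffAt (by fun_prop)
  have h2 : auxb * (fun s => Real.exp s - 1) = fun s => s * Real.exp s := funext auxb_mul
  have hk : ∀ k : ℕ, iteratedDeriv k Real.exp 0 = 1 := by
    intro k; rw [iteratedDeriv_eq_iterate]; simp
  rw [h2, aux_leib (by fun_prop), hk, Finset.sum_range_succ] at h1
  simp only [Nat.sub_self, iteratedDeriv_zero, Real.exp_zero, sub_self, mul_zero, add_zero, mul_one] at h1
  rw [h1]
  refine Finset.sum_congr rfl fun i hi => ?_
  have hi := Finset.mem_range.1 hi
  obtain ⟨m, hm⟩ : ∃ m, n - i = m + 1 := ⟨n - i - 1, by omega⟩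
  have : iteratedDeriv (m+1) (fun s => Real.exp s - 1) 0 = 1 := by
    rw [iteratedDeriv_succ']
    have : deriv (fun s => Real.exp s - 1) = Real.exp := by funext s; simp
    rw [this, hk]
  rw [hm, this, mul_one]

lemma auxb_coeff (n : ℕ) : iteratedDeriv n auxb 0 = (bernoulli' n : ℝ) := by
  induction n using Nat.strong_induction_on with
  | _ n ih =>
    have h1 := aux_sum (n+1)
    have h2 : ((∑ k ∈ Finset.range (n+1), ((n+1).choose k : ℚ) * bernoulli' k : ℚ) : ℝ) = ((n+1:ℕ):ℚ) := by
      rw [sum_bernoulli']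
    push_cast at h1 h2
    rw [Finset.sum_range_succ] at h1 h2
    rw [Finset.sum_congr rfl (fun i hi => by rw [ih i (Finset.mem_range.1 hi)])] at h1
    have h3 : ((n+1).choose n : ℝ) ≠ 0 := by
      simp; positivity
    apply mul_left_cancel₀ h3
    linarith

lemma auxG_coeff (k : ℕ) : iteratedDeriv k auxG 0 = (bernoulli' (k+1) : ℝ) / (k+1) := by
  have h := auxb_coeff (k+1)
  rw [auxb_eq, iteratedDeriv_const_add (by omega), aux_leib auxG_an] at h
  rw [← h]
  push_cast
  field_simp

noncomputable def auxF (k : ℕ) (s : ℝ) : ℝ := ∑' n : ℕ, (n:ℝ)^k * Real.exp (-(n * s))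

lemma aux_summable (k : ℕ) {s : ℝ} (hs : 0 < s) :
    Summable (fun n : ℕ => (n:ℝ)^k * Real.exp (-(n * s))) := by
  have := summable_pow_mul_geometric_of_norm_lt_one k (r := Real.exp (-s))
    (by rw [Real.norm_eq_abs, abs_of_pos (Real.exp_pos _)]; simpa using hs)
  refine this.congr fun n => ?_
  rw [← Real.exp_nat_mul]; ring_nf

lemma auxF_deriv (k : ℕ) {s : ℝ} (hs : 0 < s) : HasDerivAt (auxF k) (-auxF (k+1) s) s := by
  have h := hasDerivAt_tsum_of_isPreconnected (t := Ioi (s/2)) (y := s) (y₀ := s)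
    (g := fun (n:ℕ) s => (n:ℝ)^k * Real.exp (-(n * s)))
    (g' := fun (n:ℕ) s => -((n:ℝ)^(k+1) * Real.exp (-(n * s))))
    (aux_summable (k+1) (half_pos hs)) isOpen_Ioi isPreconnected_Ioi
    (by
      intro n y _
      have := ((((hasDerivAt_id y).const_mul (n:ℝ)).neg).exp).const_mul ((n:ℝ)^k)
      convert! this using 1
      simp; ring)
    (by
      intro n y hy
      have hy : s/2 < y := hy
      rw [norm_neg, Real.norm_eq_abs, abs_of_nonneg (by positivity)]
      gcongr)
    (by simp [hs]) (aux_summable k hs) (by simp [hs])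
  rw [tsum_neg] at h
  exact h

lemma auxF_zero {s : ℝ} (hs : 0 < s) : auxF 0 s = 1 / (1 - Real.exp (-s)) := by
  have := tsum_geometric_of_lt_one (r := Real.exp (-s)) (Real.exp_pos _).le (by simpa using hs)
  rw [one_div, ← this, auxF]
  refine tsum_congr fun n => ?_
  rw [← Real.exp_nat_mul]; ring_nf

lemma aux_iter (k : ℕ) : ∀ s : ℝ, 0 < s →
    iteratedDeriv k auxG s = (-1)^k * (auxF k s - k.factorial / s^(k+1)) := by
  induction k with
  | zero => intro s hs; simp [auxG_ne hs.ne', auxF_zero hs]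
  | succ k ih =>
    intro s hs
    rw [iteratedDeriv_succ]
    have : iteratedDeriv k auxG =ᶠ[𝓝 s] fun s => (-1)^k * (auxF k s - k.factorial / s^(k+1)) := by
      filter_upwards [Ioi_mem_nhds hs] with x hx using ih x hx
    rw [this.deriv_eq]
    have h2 := (((hasDerivAt_pow (k+1) s).inv (by positivity)).const_mul (k.factorial : ℝ))
    have h3 := ((auxF_deriv k hs).sub h2).const_mul ((-1:ℝ)^k)
    refine HasDerivAt.deriv ?_
    convert! h3 using 1
    rw [Nat.factorial_succ]
    push_cast
    field_simp
    ring

lemma aux_lim (k : ℕ) : Tendsto (fun s => auxF k s - k.factorial / s^(k+1)) (𝓝[>] 0)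
    (𝓝 (-(bernoulli (k+1) : ℝ) / (k+1))) := by
  have h1 : AnalyticAt ℝ (iteratedDeriv k auxG) 0 := by
    rw [iteratedDeriv_eq_iterate]; exact auxG_an.iterated_deriv k
  have h2 := h1.continuousAt.tendsto
  rw [auxG_coeff] at h2
  have h3 := (h2.mono_left (nhdsWithin_le_nhds (s := Ioi 0))).const_mul ((-1:ℝ)^k)
  have e : (-1:ℝ)^k * ((bernoulli' (k+1) : ℝ) / (k+1)) = -(bernoulli (k+1) : ℝ) / (k+1) := by
    rw [bernoulli]; push_cast; ring
  rw [e] at h3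
  refine h3.congr' ?_
  filter_upwards [self_mem_nhdsWithin] with s hs
  rw [aux_iter k s hs, ← mul_assoc, ← mul_pow]
  simp

/-- The value `h_{k,α}^{reg}(0)` as a limit along `t → 0⁺`, `t ∈ (0,1)`. -/
theorem reg_part_value_at_zero (α : ℝ) (hα : 0 < α) (k : ℕ) :
    Filter.Tendsto (fun t : ℝ =>
        (∑' n : ℕ, α^k * (n:ℝ)^k * (1-t) ^ ((n:ℝ)*α))
          - (1/α) * ∑' n : ℕ, (n:ℝ)^k * (1-t)^n)
      (nhdsWithin 0 (Set.Ioo 0 1))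
      (nhds (((bernoulli (k+1) : ℚ) : ℝ) * (1 - α^(k+1)) / (α * ((k:ℝ)+1)))) := by
  have hs : Tendsto (fun t : ℝ => -Real.log (1-t)) (𝓝[Ioo 0 1] 0) (𝓝[>] 0) := by
    apply tendsto_nhdsWithin_of_tendsto_nhds_of_eventually_within
    · have : ContinuousAt (fun t : ℝ => -Real.log (1-t)) 0 := by
        refine ((continuousAt_const.sub continuousAt_id).log (by simp)).neg
      have := this.tendsto
      simp only [sub_zero, Real.log_one, neg_zero] at this
      exact this.mono_left nhdsWithin_le_nhds
    · filter_upwards [self_mem_nhdsWithin] with t ht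
      have := Real.log_neg (x := 1 - t) (by linarith [ht.2]) (by linarith [ht.1])
      simp only [mem_Ioi]; linarith
  have hm : Tendsto (fun s : ℝ => α * s) (𝓝[>] 0) (𝓝[>] 0) := by
    apply tendsto_nhdsWithin_of_tendsto_nhds_of_eventually_within
    · have : ContinuousAt (fun s : ℝ => α * s) 0 := by fun_prop
      have := this.tendsto
      rw [mul_zero] at this
      exact this.mono_left nhdsWithin_le_nhds
    · filter_upwards [self_mem_nhdsWithin] with s hs
      exact mul_pos hα hs
  have h1 := (((aux_lim k).comp (hm.comp hs)).const_mul (α^k)).sub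
    (((aux_lim k).comp hs).const_mul (1/α))
  have e : α^k * (-(bernoulli (k+1) : ℝ) / (k+1)) - 1/α * (-(bernoulli (k+1) : ℝ) / (k+1))
      = ((bernoulli (k+1) : ℚ) : ℝ) * (1 - α^(k+1)) / (α * ((k:ℝ)+1)) := by
    field_simp; ring
  rw [e] at h1
  refine h1.congr' ?_
  filter_upwards [self_mem_nhdsWithin] with t ht
  have ht1 : 0 < 1 - t := by linarith [ht.2]
  have hl := Real.log_neg (x := 1 - t) ht1 (by linarith [ht.1])
  have e1 : ∑' n : ℕ, α^k * (n:ℝ)^k * (1-t) ^ ((n:ℝ)*α) = α^k * auxF k (α * -Real.log (1-t)) := by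
    rw [auxF, ← tsum_mul_left]
    refine tsum_congr fun n => ?_
    rw [Real.rpow_def_of_pos ht1, mul_assoc]
    ring_nf
  have e2 : ∑' n : ℕ, (n:ℝ)^k * (1-t)^n = auxF k (-Real.log (1-t)) := by
    rw [auxF]
    refine tsum_congr fun n => ?_
    rw [mul_neg, neg_neg, Real.exp_nat_mul, Real.exp_log ht1]
  rw [e1, e2]
  simp only [Function.comp]
  generalize auxF k _ = A
  generalize auxF k _ = B
  have hl' : Real.log (1-t) ≠ 0 := hl.ne
  rw [mul_pow]
  have : (-Real.log (1-t))^(k+1) ≠ 0 := pow_ne_zero _ (neg_ne_zero.2 hl')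
  field_simp
  ring
end

section
/- Let t > 0 and n ≥ 1 a natural number, and let γ be the contour {λ ∈ ℂ : arg(λ+1) = ±π/4} traversed upward, parametrized by the two rays λ₋(u) = −1 + u·e^{−iπ/4} (traversed from u = ∞ to u = 0) and λ₊(u) = −1 + u·e^{iπ/4} (traversed from u = 0 to u = ∞). Then, with (−λ)^{−n/2} := exp(−(n/2)·Log(−λ)) for the principal logarithm: ∫_γ e^{−tλ}(−λ)^{−n/2} dλ = (2πi/Γ(n/2))·t^{n/2−1}, and ∫_γ e^{−tλ}(−λ)^{−n/2}·Log(√(−λ)) dλ = −(πi/Γ(n/2))·t^{n/2−1}·log t + (πi·Γ'(n/2)/Γ(n/2)²)·t^{n/2−1}, where the contour integrals mean ∫₀^∞ g(λ₊(u))·e^{iπ/4} du − ∫₀^∞ g(λ₋(u))·e^{−iπ/4} du for the respective integrands g. -/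
open MeasureTheory

/-- Integral over the contour `{λ : arg(λ+1) = ±π/4}` traversed upward, parametrized by
`λ₋(u) = -1 + u·e^{-iπ/4}` (from `u = ∞` to `u = 0`) and `λ₊(u) = -1 + u·e^{iπ/4}`
(from `u = 0` to `u = ∞`). -/
noncomputable def contourIntegral (g : ℂ → ℂ) : ℂ :=
  (∫ u in Set.Ioi (0:ℝ),
      g (-1 + (u:ℂ) * Complex.exp (Complex.I * ((Real.pi/4 : ℝ) : ℂ)))
        * Complex.exp (Complex.I * ((Real.pi/4 : ℝ) : ℂ)))
  - ∫ u in Set.Ioi (0:ℝ),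
      g (-1 + (u:ℂ) * Complex.exp (-(Complex.I * ((Real.pi/4 : ℝ) : ℂ))))
        * Complex.exp (-(Complex.I * ((Real.pi/4 : ℝ) : ℂ)))

lemma aux_rpow_tendsto (R b : ℝ) (hb : 0 < b) :
    Filter.Tendsto (fun u : ℝ => (2 + u) ^ R * Real.exp (-b * u)) Filter.atTop (nhds 0) := by
  have h := (tendsto_rpow_mul_exp_neg_mul_atTop_nhds_zero R b hb).comp
    (Filter.tendsto_atTop_add_const_left Filter.atTop (2:ℝ) Filter.tendsto_id)
  have h2 := h.const_mul (Real.exp (2 * b))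
  rw [mul_zero] at h2
  refine h2.congr fun u => ?_
  simp only [Function.comp, id]
  rw [mul_left_comm, ← Real.exp_add]
  ring_nf

lemma aux_rpow_integrable (R b : ℝ) (hb : 0 < b) :
    IntegrableOn (fun u : ℝ => (2 + u) ^ R * Real.exp (-b * u)) (Set.Ioi 0) := by
  refine integrable_of_isBigO_exp_neg (b := b / 2) (by positivity) ?_ ?_
  · refine ContinuousOn.mul (ContinuousOn.rpow_const (by fun_prop) ?_) (by fun_prop)
    intro x hx
    left
    have : (0:ℝ) ≤ x := hx
    positivity
  · have h := (aux_rpow_tendsto R (b / 2) (by positivity)).isBigO_one ℝ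
    have h2 := h.mul (Asymptotics.isBigO_refl (fun x : ℝ => Real.exp (-(b / 2) * x)) Filter.atTop)
    refine (h2.congr_left fun u => ?_).congr_right fun u => one_mul _
    rw [mul_assoc, ← Real.exp_add]
    ring_nf

lemma aux_log_norm (w : ℂ) (v : ℝ) (hv : 2 ≤ v) (h1 : 1 / 2 ≤ ‖w‖) (h2 : ‖w‖ ≤ v) :
    ‖Complex.log w‖ ≤ Real.log v + Real.pi := by
  have hw : 0 < ‖w‖ := by linarith
  have e : Complex.log w = ((Real.log ‖w‖ : ℝ) : ℂ) + ((Complex.arg w : ℝ) : ℂ) * Complex.I := rfl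
  rw [e]
  refine (norm_add_le _ _).trans (add_le_add ?_ ?_)
  · rw [Complex.norm_real, Real.norm_eq_abs, abs_le]
    constructor
    · have : Real.log (1 / v) ≤ Real.log ‖w‖ := by
        apply Real.log_le_log (by positivity)
        refine le_trans ?_ h1
        exact one_div_le_one_div_of_le (by norm_num) hv
      rw [one_div, Real.log_inv] at this
      exact this
    · exact Real.log_le_log hw h2
  · rw [norm_mul, Complex.norm_I, mul_one, Complex.norm_real]
    exact Complex.abs_arg_le_pi w

/-- admissible directions -/
structure Dir (ω : ℂ) : Prop where
  re : ω.re = -(√2 / 2)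
  im : ω.im ^ 2 = 1 / 2

namespace Dir

lemma im_ne {ω : ℂ} (h : Dir ω) : ω.im ≠ 0 := by
  intro h0
  have := h.im
  rw [h0] at this
  norm_num at this

lemma norm_eq {ω : ℂ} (h : Dir ω) : ‖ω‖ = 1 := by
  have : ‖ω‖ ^ 2 = 1 := by
    rw [Complex.sq_norm, Complex.normSq_apply, h.re, ← pow_two ω.im, h.im]
    have : √2 * √2 = 2 := Real.mul_self_sqrt (by norm_num)
    linarith
  have h0 := norm_nonneg ω
  nlinarith

lemma re_add {ω : ℂ} (h : Dir ω) (x u : ℝ) : ((x:ℂ) + u * ω).re = x - (√2 / 2) * u := by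
  simp [h.re]; ring

lemma slit {ω : ℂ} (h : Dir ω) (x u : ℝ) (hu : 0 < u) : (x:ℂ) + u * ω ∈ Complex.slitPlane := by
  right
  simp [h.im_ne, hu.ne']

lemma norm_le {ω : ℂ} (h : Dir ω) (x u : ℝ) (hx : |x| ≤ 2) (hu : 0 ≤ u) : ‖(x:ℂ) + u * ω‖ ≤ 2 + u := by
  refine (norm_add_le _ _).trans ?_
  rw [norm_mul, h.norm_eq, Complex.norm_real, Complex.norm_real, Real.norm_eq_abs, Real.norm_eq_abs,
    abs_of_nonneg hu]
  linarith

lemma half_le {ω : ℂ} (h : Dir ω) (u : ℝ) : 1 / 2 ≤ ‖(1:ℂ) + u * ω‖ := by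
  have e : ‖(1:ℂ) + u * ω‖ ^ 2 = 1 - √2 * u + u ^ 2 := by
    rw [Complex.sq_norm, Complex.normSq_apply]
    have h2 : √2 * √2 = 2 := Real.mul_self_sqrt (by norm_num)
    have h3 := h.im
    simp [h.re]
    linear_combination u ^ 2 * h3 + u ^ 2 / 4 * h2
  have h2 : √2 * √2 = 2 := Real.mul_self_sqrt (by norm_num)
  have h0 := norm_nonneg ((1:ℂ) + u * ω)
  nlinarith [sq_nonneg (u - √2 / 2)]

end Dir

/-- The ray integral as function of the exponent. -/
noncomputable def rayInt (t : ℝ) (ω z : ℂ) : ℂ :=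
  ∫ u in Set.Ioi (0:ℝ), Complex.exp (t * (1 + u * ω)) * Complex.exp (-z * Complex.log (1 + u * ω)) * ω

lemma exp_log_bound (t : ℝ) {ω : ℂ} (h : Dir ω) (u : ℝ) (hu : 0 < u) (z : ℂ) (R : ℝ)
    (hz : ‖z‖ ≤ R) :
    ‖Complex.exp (t * (1 + u * ω)) * Complex.exp (-z * Complex.log (1 + u * ω)) * ω‖ ≤
      (Real.exp t * Real.exp (R * Real.pi)) * ((2 + u) ^ R * Real.exp (-(t * (√2 / 2)) * u)) := by
  rw [norm_mul, norm_mul, h.norm_eq, mul_one]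
  have hn := h.norm_le 1 u (by norm_num) hu.le
  have hre := h.re_add 1 u
  rw [Complex.ofReal_one] at hn hre
  have hl := aux_log_norm _ (2 + u) (by linarith) (h.half_le u) hn
  have e1 : ‖Complex.exp (t * (1 + u * ω))‖ = Real.exp t * Real.exp (-(t * (√2 / 2)) * u) := by
    rw [Complex.norm_exp, Complex.re_ofReal_mul, hre, ← Real.exp_add]
    ring_nf
  have e2 : ‖Complex.exp (-z * Complex.log (1 + u * ω))‖ ≤ (2 + u) ^ R * Real.exp (R * Real.pi) := by
    rw [Complex.norm_exp, Real.rpow_def_of_pos (by linarith), ← Real.exp_add]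
    apply Real.exp_le_exp.mpr
    refine (Complex.re_le_norm _).trans ?_
    rw [norm_mul, norm_neg]
    have := mul_le_mul hz hl (norm_nonneg _) ((norm_nonneg _).trans hz)
    linarith
  rw [e1]
  calc _ ≤ Real.exp t * Real.exp (-(t * (√2 / 2)) * u) * ((2 + u) ^ R * Real.exp (R * Real.pi)) := by
        gcongr
    _ = _ := by ring

lemma rayInt_hasDerivAt (t : ℝ) (ht : 0 < t) {ω : ℂ} (h : Dir ω) (z : ℂ) :
    HasDerivAt (rayInt t ω) (∫ u in Set.Ioi (0:ℝ), Complex.exp (t * (1 + u * ω)) *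
      Complex.exp (-z * Complex.log (1 + u * ω)) * ω * (-Complex.log (1 + u * ω))) z := by
  have hb : 0 < t * (√2 / 2) := by positivity
  refine (hasDerivAt_integral_of_dominated_loc_of_deriv_le (μ := volume.restrict (Set.Ioi (0:ℝ)))
    (F := fun z (u:ℝ) => Complex.exp (t * (1 + u * ω)) * Complex.exp (-z * Complex.log (1 + u * ω)) * ω)
    (F' := fun z (u:ℝ) => Complex.exp (t * (1 + u * ω)) *
      Complex.exp (-z * Complex.log (1 + u * ω)) * ω * (-Complex.log (1 + u * ω)))
    (x₀ := z) (s := Metric.ball z 1)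
    (bound := fun u => (Real.exp t * Real.exp ((‖z‖ + 1) * Real.pi) * Real.exp Real.pi) *
      ((2 + u) ^ (‖z‖ + 2) * Real.exp (-(t * (√2 / 2)) * u)))
    (Metric.ball_mem_nhds z one_pos) ?_ ?_ ?_ ?_ ?_ ?_).2
  · refine Filter.Eventually.of_forall fun z => Measurable.aestronglyMeasurable ?_
    fun_prop
  · refine Integrable.mono' ((aux_rpow_integrable ‖z‖ _ hb).const_mul
      (Real.exp t * Real.exp (‖z‖ * Real.pi))) (Measurable.aestronglyMeasurable (by fun_prop)) ?_
    filter_upwards [ae_restrict_mem measurableSet_Ioi] with u hu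
    exact exp_log_bound t h u hu z _ le_rfl
  · exact Measurable.aestronglyMeasurable (by fun_prop)
  · filter_upwards [ae_restrict_mem measurableSet_Ioi] with u hu x hx
    have hu : 0 < u := hu
    have hx' : ‖x‖ ≤ ‖z‖ + 1 := by
      have : ‖x - z‖ < 1 := by simpa [dist_eq_norm] using hx
      have := norm_le_norm_add_norm_sub z x
      rw [norm_sub_rev] at this
      linarith
    rw [norm_mul, norm_neg]
    have b1 := exp_log_bound t h u hu x _ hx'
    have hn := h.norm_le 1 u (by norm_num) hu.le
    rw [Complex.ofReal_one] at hn
    have hl := aux_log_norm _ (2 + u) (by linarith) (h.half_le u) hn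
    have hl2 : ‖Complex.log (1 + u * ω)‖ ≤ (2 + u) * Real.exp Real.pi := by
      refine hl.trans ?_
      have := Real.add_one_le_exp (Real.log (2 + u) + Real.pi)
      rw [Real.exp_add, Real.exp_log (by linarith)] at this
      linarith
    refine (mul_le_mul b1 hl2 (norm_nonneg _) (by positivity)).trans (le_of_eq ?_)
    rw [show ‖z‖ + 2 = (‖z‖ + 1) + 1 by ring, Real.rpow_add_one (by linarith) (‖z‖ + 1)]
    ring
  · exact (aux_rpow_integrable _ _ hb).const_mul _
  · refine Filter.Eventually.of_forall fun u x _ => ?_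
    have h1 : HasDerivAt (fun x : ℂ => -x * Complex.log (1 + u * ω)) (-1 * Complex.log (1 + u * ω)) x :=
      (hasDerivAt_id x).neg.mul_const _
    have := ((h1.cexp).const_mul (Complex.exp (t * (1 + u * ω)))).mul_const ω
    refine this.congr_deriv ?_
    ring

lemma gamma_complex (s : ℝ) (hs : 0 < s) (r : ℂ) (hr : 0 < r.re) :
    ∫ u in Set.Ioi (0:ℝ), (u:ℂ) ^ (s:ℂ) * Complex.exp (-(r * u)) =
      Complex.exp (-(s + 1) * Complex.log r) * Complex.Gamma (s + 1) := by
  have hopen : IsOpen {r : ℂ | 0 < r.re} := isOpen_lt continuous_const Complex.continuous_re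
  have hd : ∀ r : ℂ, 0 < r.re → DifferentiableAt ℂ
      (fun r : ℂ => ∫ u in Set.Ioi (0:ℝ), (u:ℂ) ^ (s:ℂ) * Complex.exp (-(r * u))) r := by
    intro r hr
    have bd : ∀ (x : ℂ) (b : ℝ) (u : ℝ), 0 < u → b ≤ x.re →
        ‖(u:ℂ) ^ (s:ℂ) * Complex.exp (-(x * u))‖ ≤ u ^ s * Real.exp (-b * u ^ (1:ℝ)) := by
      intro x b u hu hb
      rw [norm_mul, Complex.norm_cpow_real, Complex.norm_exp, Complex.norm_real, Real.norm_eq_abs,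
        abs_of_pos hu, Real.rpow_one]
      gcongr
      simp
      nlinarith
    refine (hasDerivAt_integral_of_dominated_loc_of_deriv_le (μ := volume.restrict (Set.Ioi (0:ℝ)))
      (F := fun r (u:ℝ) => (u:ℂ) ^ (s:ℂ) * Complex.exp (-(r * u)))
      (F' := fun r (u:ℝ) => (u:ℂ) ^ (s:ℂ) * Complex.exp (-(r * u)) * (-u))
      (x₀ := r) (s := {x : ℂ | r.re / 2 < x.re})
      (bound := fun u => u ^ (s + 1) * Real.exp (-(r.re / 2) * u ^ (1:ℝ)))
      ?_ ?_ ?_ ?_ ?_ ?_ ?_).2.differentiableAt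
    · exact (isOpen_lt continuous_const Complex.continuous_re).mem_nhds (by simp; linarith)
    · exact Filter.Eventually.of_forall fun z => Measurable.aestronglyMeasurable (by fun_prop)
    · refine Integrable.mono' (integrableOn_rpow_mul_exp_neg_mul_rpow (p := 1) (s := s) (b := r.re)
        (by linarith) one_pos hr) (Measurable.aestronglyMeasurable (by fun_prop)) ?_
      filter_upwards [ae_restrict_mem measurableSet_Ioi] with u hu
      exact bd r _ u hu le_rfl
    · exact Measurable.aestronglyMeasurable (by fun_prop)
    · filter_upwards [ae_restrict_mem measurableSet_Ioi] with u hu x hx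
      have hu : 0 < u := hu
      have hx : r.re / 2 < x.re := hx
      rw [norm_mul, norm_neg, Complex.norm_real, Real.norm_eq_abs, abs_of_pos hu]
      refine (mul_le_mul_of_nonneg_right (bd x _ u hu hx.le) hu.le).trans (le_of_eq ?_)
      rw [Real.rpow_add_one hu.ne']
      ring
    · exact integrableOn_rpow_mul_exp_neg_mul_rpow (by linarith) one_pos (by linarith)
    · refine Filter.Eventually.of_forall fun u x _ => ?_
      have h1 : HasDerivAt (fun x : ℂ => -(x * u)) (-(1 * (u:ℂ))) x :=
        ((hasDerivAt_id x).mul_const _).neg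
      refine ((h1.cexp).const_mul ((u:ℂ) ^ (s:ℂ))).congr_deriv ?_
      ring
  have hA : AnalyticOnNhd ℂ
      (fun r : ℂ => ∫ u in Set.Ioi (0:ℝ), (u:ℂ) ^ (s:ℂ) * Complex.exp (-(r * u)))
      {r : ℂ | 0 < r.re} :=
    DifferentiableOn.analyticOnNhd (fun r hr => (hd r hr).differentiableWithinAt) hopen
  have hB : AnalyticOnNhd ℂ
      (fun r : ℂ => Complex.exp (-(s + 1) * Complex.log r) * Complex.Gamma (s + 1))
      {r : ℂ | 0 < r.re} := by
    refine DifferentiableOn.analyticOnNhd (fun r hr => ?_) hopen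
    have : DifferentiableAt ℂ Complex.log r := Complex.differentiableAt_log (Or.inl hr)
    exact (((this.const_mul _).cexp).mul_const _).differentiableWithinAt
  have hpre : IsPreconnected {r : ℂ | 0 < r.re} := (convex_halfSpace_re_gt 0).isPreconnected
  refine hA.eqOn_of_preconnected_of_frequently_eq hB hpre (z₀ := 1) (by simp) ?_ hr
  have ht : Filter.Tendsto (fun x : ℝ => (x:ℂ)) (nhdsWithin 1 {1}ᶜ) (nhdsWithin 1 {1}ᶜ) := by
    apply tendsto_nhdsWithin_of_tendsto_nhds_of_eventually_within
    · exact (Complex.continuous_ofReal.tendsto' 1 1 (by simp)).mono_left nhdsWithin_le_nhds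
    · filter_upwards [self_mem_nhdsWithin] with x hx
      simpa using hx
  refine ht.frequently (Filter.Eventually.frequently ?_)
  filter_upwards [mem_nhdsWithin_of_mem_nhds (Ioi_mem_nhds (show (0:ℝ) < 1 by norm_num))] with x hx
  have hx : 0 < x := hx
  have := Complex.integral_cpow_mul_exp_neg_mul_Ioi (a := s + 1) (r := x) (by simp; linarith) hx
  rw [add_sub_cancel_right] at this
  rw [this]
  congr 1
  rw [one_div, Complex.cpow_def_of_ne_zero (by simp [hx.ne']), ← Complex.ofReal_inv,
    ← Complex.ofReal_log (by positivity), ← Complex.ofReal_log hx.le, Real.log_inv]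
  push_cast
  ring_nf

lemma shift_hasDerivAt (t : ℝ) (ht : 0 < t) {ω : ℂ} (h : Dir ω) (s : ℝ) (hs : 1 < s) (c : ℝ)
    (hc0 : 0 ≤ c) (hc1 : c ≤ 1) :
    HasDerivAt (fun c : ℝ => ∫ u in Set.Ioi (0:ℝ),
      Complex.exp (t * (c + u * ω)) * ((c:ℂ) + u * ω) ^ (s:ℂ) * ω)
      (-(Complex.exp (t * c) * (c:ℂ) ^ (s:ℂ))) c := by
  have hb : 0 < t * (√2 / 2) := by positivity
  have en : ∀ (x u : ℝ), |x| ≤ 2 → ‖Complex.exp (t * (x + u * ω))‖ ≤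
      Real.exp (2 * t) * Real.exp (-(t * (√2 / 2)) * u) := by
    intro x u hx
    rw [Complex.norm_exp, Complex.re_ofReal_mul, h.re_add, ← Real.exp_add]
    apply Real.exp_le_exp.mpr
    have := (abs_le.mp hx).2
    nlinarith
  have bd : ∀ (x u : ℝ), |x| ≤ 2 → 0 < u →
      ‖Complex.exp (t * (x + u * ω)) * ((x:ℂ) + u * ω) ^ (s:ℂ)‖ ≤
        Real.exp (2 * t) * ((2 + u) ^ s * Real.exp (-(t * (√2 / 2)) * u)) := by
    intro x u hx hu
    rw [norm_mul, Complex.norm_cpow_real]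
    have h1 := en x u hx
    have h2 : ‖(x:ℂ) + u * ω‖ ^ s ≤ (2 + u) ^ s :=
      Real.rpow_le_rpow (norm_nonneg _) (h.norm_le x u hx hu.le) (by linarith)
    calc _ ≤ (Real.exp (2 * t) * Real.exp (-(t * (√2 / 2)) * u)) * (2 + u) ^ s := by gcongr
      _ = _ := by ring
  have hder : ∀ w : ℂ, w ∈ Complex.slitPlane →
      HasDerivAt (fun w : ℂ => Complex.exp (t * w) * w ^ (s:ℂ))
        (Complex.exp (t * w) * (t * w ^ (s:ℂ) + s * w ^ (((s - 1 : ℝ)):ℂ))) w := by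
    intro w hw
    have h1 : HasDerivAt (fun w : ℂ => (t:ℂ) * w) (t * 1) w := (hasDerivAt_id w).const_mul _
    have h2 := (hasDerivAt_id w).cpow_const (c := (s:ℂ)) hw
    refine (h1.cexp.mul h2).congr_deriv ?_
    simp only [id]
    push_cast
    ring
  have key := hasDerivAt_integral_of_dominated_loc_of_deriv_le
    (μ := volume.restrict (Set.Ioi (0:ℝ)))
    (F := fun (c:ℝ) (u:ℝ) => Complex.exp (t * (c + u * ω)) * ((c:ℂ) + u * ω) ^ (s:ℂ) * ω)
    (F' := fun (c:ℝ) (u:ℝ) => Complex.exp (t * (c + u * ω)) *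
      (t * ((c:ℂ) + u * ω) ^ (s:ℂ) + s * ((c:ℂ) + u * ω) ^ (((s - 1 : ℝ)):ℂ)) * ω)
    (x₀ := c) (s := Metric.ball c 1)
    (bound := fun u => (Real.exp (2 * t) * (t + s)) *
      ((2 + u) ^ s * Real.exp (-(t * (√2 / 2)) * u)))
    (Metric.ball_mem_nhds c one_pos) ?_ ?_ ?_ ?_ ?_ ?_
  · obtain ⟨hi, hd⟩ := key
    refine hd.congr_deriv ?_
    have := integral_Ioi_of_hasDerivAt_of_tendsto (a := 0) (m := 0)
      (f := fun u : ℝ => Complex.exp (t * (c + u * ω)) * ((c:ℂ) + u * ω) ^ (s:ℂ))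
      ?_ ?_ hi ?_
    · rw [this]; simp
    · apply ContinuousAt.continuousWithinAt
      have h1 : ContinuousAt (fun w : ℂ => w ^ (s:ℂ)) ((c:ℂ) + (0:ℝ) * ω) :=
        Complex.continuousAt_cpow_const_of_re_pos (by left; simpa using hc0) (by simp; linarith)
      have h2 : ContinuousAt (fun u : ℝ => (c:ℂ) + u * ω) 0 := by fun_prop
      have h3 : ContinuousAt (fun u : ℝ => ((c:ℂ) + u * ω) ^ (s:ℂ)) 0 :=
        ContinuousAt.comp (f := fun u : ℝ => (c:ℂ) + u * ω) (g := fun w : ℂ => w ^ (s:ℂ)) h1 h2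
      exact ContinuousAt.mul (by fun_prop) h3
    · intro u hu
      have h1 : HasDerivAt (fun u : ℝ => (c:ℂ) + u * ω) ω u := by
        simpa using ((Complex.ofRealCLM.hasDerivAt (x := u)).mul_const ω).const_add (c:ℂ)
      exact HasDerivAt.comp u (hder _ (h.slit c u hu)) h1
    · have := (aux_rpow_tendsto s _ hb).const_mul (Real.exp (2 * t))
      rw [mul_zero] at this
      refine squeeze_zero_norm' ?_ this
      filter_upwards [Filter.eventually_gt_atTop 0] with u hu
      exact bd c u (by rw [abs_of_nonneg hc0]; linarith) hu
  · exact Filter.Eventually.of_forall fun z => Measurable.aestronglyMeasurable (by fun_prop)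
  · refine Integrable.mono' ((aux_rpow_integrable s _ hb).const_mul (Real.exp (2 * t)))
      (Measurable.aestronglyMeasurable (by fun_prop)) ?_
    filter_upwards [ae_restrict_mem measurableSet_Ioi] with u hu
    rw [norm_mul, h.norm_eq, mul_one]
    exact bd c u (by rw [abs_of_nonneg hc0]; linarith) hu
  · exact Measurable.aestronglyMeasurable (by fun_prop)
  · filter_upwards [ae_restrict_mem measurableSet_Ioi] with u hu x hx
    have hu : 0 < u := hu
    have hx' : |x| ≤ 2 := by
      have : |x - c| < 1 := by simpa [Real.dist_eq] using hx
      rw [abs_lt] at this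
      rw [abs_le]
      constructor <;> linarith
    rw [norm_mul, h.norm_eq, mul_one, norm_mul]
    have hn := h.norm_le x u hx' hu.le
    have h2 : ‖(x:ℂ) + u * ω‖ ^ s ≤ (2 + u) ^ s :=
      Real.rpow_le_rpow (norm_nonneg _) hn (by linarith)
    have h3 : ‖(x:ℂ) + u * ω‖ ^ (s - 1) ≤ (2 + u) ^ s :=
      (Real.rpow_le_rpow (norm_nonneg _) hn (by linarith)).trans
        (Real.rpow_le_rpow_of_exponent_le (by linarith) (by linarith))
    have h4 : ‖t * ((x:ℂ) + u * ω) ^ (s:ℂ) + s * ((x:ℂ) + u * ω) ^ (((s - 1 : ℝ)):ℂ)‖ ≤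
        (t + s) * (2 + u) ^ s := by
      refine (norm_add_le _ _).trans ?_
      rw [norm_mul, norm_mul, Complex.norm_cpow_real, Complex.norm_cpow_real, Complex.norm_real,
        Complex.norm_real, Real.norm_eq_abs, Real.norm_eq_abs, abs_of_pos ht,
        abs_of_pos (by linarith : 0 < s), add_mul]
      gcongr
    refine (mul_le_mul (en x u hx') h4 (norm_nonneg _) (by positivity)).trans (le_of_eq ?_)
    ring
  · exact (aux_rpow_integrable _ _ hb).const_mul _
  · filter_upwards [ae_restrict_mem measurableSet_Ioi] with u hu x _
    have h1 : HasDerivAt (fun x : ℝ => (x:ℂ) + u * ω) 1 x :=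
      (Complex.ofRealCLM.hasDerivAt (x := x)).add_const _
    have := (HasDerivAt.comp x (hder _ (h.slit x u hu)) h1).mul_const ω
    rw [mul_one] at this
    exact this

lemma rayInt_diff (t : ℝ) (ht : 0 < t) {ω₁ ω₂ : ℂ} (h₁ : Dir ω₁) (h₂ : Dir ω₂) (s : ℝ)
    (hs : 1 < s) :
    rayInt t ω₁ (-s) - rayInt t ω₂ (-s) =
      (∫ u in Set.Ioi (0:ℝ), Complex.exp (t * (u * ω₁)) * ((u:ℂ) * ω₁) ^ (s:ℂ) * ω₁) -
      (∫ u in Set.Ioi (0:ℝ), Complex.exp (t * (u * ω₂)) * ((u:ℂ) * ω₂) ^ (s:ℂ) * ω₂) := by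
  have e : ∀ ω : ℂ, Dir ω → rayInt t ω (-s) = ∫ u in Set.Ioi (0:ℝ),
      Complex.exp (t * ((1:ℝ) + u * ω)) * (((1:ℝ):ℂ) + u * ω) ^ (s:ℂ) * ω := by
    intro ω h
    refine setIntegral_congr_fun measurableSet_Ioi fun u hu => ?_
    have hne := Complex.slitPlane_ne_zero (h.slit 1 u hu)
    rw [Complex.ofReal_one] at hne
    simp only [Complex.ofReal_one, neg_neg]
    rw [Complex.cpow_def_of_ne_zero hne, mul_comm (s:ℂ)]
  have hD : ∀ c ∈ Set.Icc (0:ℝ) 1, HasDerivAt (fun c : ℝ =>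
      (∫ u in Set.Ioi (0:ℝ), Complex.exp (t * (c + u * ω₁)) * ((c:ℂ) + u * ω₁) ^ (s:ℂ) * ω₁) -
      (∫ u in Set.Ioi (0:ℝ), Complex.exp (t * (c + u * ω₂)) * ((c:ℂ) + u * ω₂) ^ (s:ℂ) * ω₂))
      0 c := by
    intro c hc
    refine ((shift_hasDerivAt t ht h₁ s hs c hc.1 hc.2).sub
      (shift_hasDerivAt t ht h₂ s hs c hc.1 hc.2)).congr_deriv (sub_self _)
  have := constant_of_has_deriv_right_zero
    (fun c hc => (hD c hc).continuousAt.continuousWithinAt)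
    (fun c hc => (hD c ⟨hc.1, hc.2.le⟩).hasDerivWithinAt) 1 (by simp)
  rw [e _ h₁, e _ h₂, this]
  simp

/-- angle version: ω = e^{iθ}, −ω = e^{iφ}. -/
lemma vertex_zero (t : ℝ) (ht : 0 < t) (s : ℝ) (hs : 1 < s) (ω L L' : ℂ) (h : Dir ω)
    (hL : Complex.log ω = L) (hL' : Complex.log (-ω) = L') :
    (∫ u in Set.Ioi (0:ℝ), Complex.exp (t * (u * ω)) * ((u:ℂ) * ω) ^ (s:ℂ) * ω) =
      Complex.exp ((s + 1) * (L - L')) * (Complex.exp (-(s + 1) * Real.log t) *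
        Complex.Gamma (s + 1)) := by
  have hω : ω ≠ 0 := by
    intro h0
    have := h.norm_eq
    simp [h0] at this
  have hg := gamma_complex s (by linarith) (t * (-ω)) (by
    rw [Complex.re_ofReal_mul, Complex.neg_re, h.re]; simp; positivity)
  rw [Complex.log_ofReal_mul ht (neg_ne_zero.mpr hω), hL'] at hg
  have : ∀ u ∈ Set.Ioi (0:ℝ), Complex.exp (t * (u * ω)) * ((u:ℂ) * ω) ^ (s:ℂ) * ω =
      Complex.exp ((s + 1) * L) * ((u:ℂ) ^ (s:ℂ) * Complex.exp (-(t * (-ω) * u))) := by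
    intro u hu
    have hu : 0 < u := hu
    have hu' : (u:ℂ) ≠ 0 := by simp [hu.ne']
    rw [Complex.cpow_def_of_ne_zero (mul_ne_zero hu' hω), Complex.cpow_def_of_ne_zero hu',
      Complex.log_ofReal_mul hu hω, hL, Complex.ofReal_log hu.le]
    have : ω = Complex.exp L := by rw [← hL, Complex.exp_log hω]
    conv_lhs => rw [show ∀ a b : ℂ, a * b * ω = a * (b * ω) from fun a b => mul_assoc _ _ _]
    conv_lhs =>
      arg 2
      rw [this]
    rw [← Complex.exp_add, ← Complex.exp_add, ← Complex.exp_add, ← Complex.exp_add]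
    ring_nf
  rw [setIntegral_congr_fun measurableSet_Ioi this, integral_const_mul, hg, ← mul_assoc,
    ← mul_assoc, ← Complex.exp_add, ← Complex.exp_add]
  ring_nf

noncomputable def ωp : ℂ := -Complex.exp (Complex.I * ((Real.pi/4 : ℝ) : ℂ))
noncomputable def ωm : ℂ := -Complex.exp (-(Complex.I * ((Real.pi/4 : ℝ) : ℂ)))

lemma exp_p : Complex.exp (Complex.I * ((Real.pi/4 : ℝ) : ℂ)) = ⟨√2 / 2, √2 / 2⟩ := by
  rw [mul_comm, Complex.exp_mul_I, ← Complex.ofReal_cos, ← Complex.ofReal_sin, Real.cos_pi_div_four,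
    Real.sin_pi_div_four]
  apply Complex.ext <;> simp

lemma exp_m : Complex.exp (-(Complex.I * ((Real.pi/4 : ℝ) : ℂ))) = ⟨√2 / 2, -(√2 / 2)⟩ := by
  rw [show -(Complex.I * ((Real.pi/4 : ℝ) : ℂ)) = ((-(Real.pi/4) : ℝ) : ℂ) * Complex.I by
    push_cast; ring, Complex.exp_mul_I, ← Complex.ofReal_cos, ← Complex.ofReal_sin, Real.cos_neg,
    Real.sin_neg, Real.cos_pi_div_four, Real.sin_pi_div_four]
  apply Complex.ext <;> simp

lemma dir_p : Dir ωp := by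
  rw [ωp, exp_p]
  constructor
  · simp
  · simp [div_pow]; norm_num

lemma dir_m : Dir ωm := by
  rw [ωm, exp_m]
  constructor
  · simp
  · simp [div_pow]; norm_num

lemma log_negp : Complex.log (-ωp) = Complex.I * ((Real.pi/4 : ℝ) : ℂ) := by
  rw [ωp, neg_neg, Complex.log_exp] <;> simp <;> linarith [Real.pi_pos]

lemma log_negm : Complex.log (-ωm) = -(Complex.I * ((Real.pi/4 : ℝ) : ℂ)) := by
  rw [ωm, neg_neg, Complex.log_exp] <;> simp <;> linarith [Real.pi_pos]

lemma log_p : Complex.log ωp = Complex.I * ((Real.pi/4 : ℝ) : ℂ) - Real.pi * Complex.I := by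
  have : ωp = Complex.exp (Complex.I * ((Real.pi/4 : ℝ) : ℂ) - Real.pi * Complex.I) := by
    rw [Complex.exp_sub, Complex.exp_pi_mul_I, ωp]; ring
  rw [this, Complex.log_exp] <;> simp <;> linarith [Real.pi_pos]

lemma log_m : Complex.log ωm = -(Complex.I * ((Real.pi/4 : ℝ) : ℂ)) + Real.pi * Complex.I := by
  have : ωm = Complex.exp (-(Complex.I * ((Real.pi/4 : ℝ) : ℂ)) + Real.pi * Complex.I) := by
    rw [Complex.exp_add, Complex.exp_pi_mul_I, ωm]; ring
  rw [this, Complex.log_exp] <;> simp <;> linarith [Real.pi_pos]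

lemma hankel_neg (t : ℝ) (ht : 0 < t) (s : ℝ) (hs : 1 < s) :
    rayInt t ωm (-s) - rayInt t ωp (-s) =
      2 * (Real.pi : ℂ) * Complex.I * (t:ℂ) ^ (-(s:ℂ) - 1) * (Complex.Gamma (-s))⁻¹ := by
  rw [rayInt_diff t ht dir_m dir_p s hs, vertex_zero t ht s hs ωm _ _ dir_m log_m log_negm,
    vertex_zero t ht s hs ωp _ _ dir_p log_p log_negp,
    Complex.cpow_def_of_ne_zero (by simp [ht.ne']), ← Complex.ofReal_log ht.le]
  have hG := Complex.Gamma_mul_Gamma_one_sub (s + 1)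
  rw [show (1:ℂ) - (s + 1) = -s by ring] at hG
  have hne : Complex.Gamma (s + 1) ≠ 0 := by
    apply Complex.Gamma_ne_zero_of_re_pos
    simp; linarith
  have hsin : Complex.exp ((s + 1) * (-(Complex.I * ((Real.pi/4 : ℝ) : ℂ)) + Real.pi * Complex.I
        - -(Complex.I * ((Real.pi/4 : ℝ) : ℂ)))) -
      Complex.exp ((s + 1) * (Complex.I * ((Real.pi/4 : ℝ) : ℂ) - Real.pi * Complex.I -
        Complex.I * ((Real.pi/4 : ℝ) : ℂ))) = 2 * Complex.I * Complex.sin (Real.pi * (s + 1)) := by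
    rw [Complex.sin]
    ring_nf
    rw [Complex.I_sq]
    ring_nf
  rw [← sub_mul, hsin]
  have hpi : (Real.pi : ℂ) ≠ 0 := by simp [Real.pi_ne_zero]
  have hG2 : Complex.Gamma (-s) = Real.pi / Complex.sin (Real.pi * (s + 1)) / Complex.Gamma (s + 1) := by
    rw [← hG]; field_simp
  rw [hG2, inv_div, div_div_eq_mul_div]
  rw [show (Real.log t : ℂ) * (-(s:ℂ) - 1) = -(s + 1) * Real.log t by ring]
  field_simp

lemma hankel (t : ℝ) (ht : 0 < t) :
    (fun z => rayInt t ωm z - rayInt t ωp z) =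
      fun z => 2 * (Real.pi : ℂ) * Complex.I * (t:ℂ) ^ (z - 1) * (Complex.Gamma z)⁻¹ := by
  have htc : (t:ℂ) ≠ 0 := by simp [ht.ne']
  refine AnalyticOnNhd.eq_of_frequently_eq (z₀ := -2) ?_ ?_ ?_
  · refine DifferentiableOn.analyticOnNhd (fun z _ => ?_) isOpen_univ
    exact ((rayInt_hasDerivAt t ht dir_m z).sub
      (rayInt_hasDerivAt t ht dir_p z)).differentiableAt.differentiableWithinAt
  · refine DifferentiableOn.analyticOnNhd (fun z _ => ?_) isOpen_univ
    apply DifferentiableAt.differentiableWithinAt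
    have h1 : DifferentiableAt ℂ (fun z : ℂ => (t:ℂ) ^ (z - 1)) z :=
      DifferentiableAt.const_cpow (by fun_prop) (Or.inl htc)
    exact (h1.const_mul _).mul (Complex.differentiable_one_div_Gamma z)
  · have hT : Filter.Tendsto (fun x : ℝ => -(x:ℂ)) (nhdsWithin 2 {2}ᶜ) (nhdsWithin (-2) {-2}ᶜ) := by
      apply tendsto_nhdsWithin_of_tendsto_nhds_of_eventually_within
      · exact (Complex.continuous_ofReal.neg.tendsto' 2 (-2) (by simp)).mono_left nhdsWithin_le_nhds
      · filter_upwards [self_mem_nhdsWithin] with x hx hx2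
        apply hx
        have : (x:ℂ) = 2 := neg_injective (by simpa using hx2)
        exact_mod_cast this
    refine hT.frequently (Filter.Eventually.frequently ?_)
    filter_upwards [mem_nhdsWithin_of_mem_nhds (Ioi_mem_nhds (show (1:ℝ) < 2 by norm_num))] with x hx
    exact hankel_neg t ht x hx

lemma contour_eq (t : ℝ) (z : ℂ) (k : ℂ → ℂ) :
    contourIntegral (fun lam => Complex.exp (-(t:ℂ) * lam) * Complex.exp (-z * Complex.log (-lam))
      * k (-lam)) =
    (∫ u in Set.Ioi (0:ℝ), Complex.exp (t * (1 + u * ωm)) *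
      Complex.exp (-z * Complex.log (1 + u * ωm)) * ωm * k (1 + u * ωm)) -
    (∫ u in Set.Ioi (0:ℝ), Complex.exp (t * (1 + u * ωp)) *
      Complex.exp (-z * Complex.log (1 + u * ωp)) * ωp * k (1 + u * ωp)) := by
  have e : ∀ (ρ : ℂ), (∫ u in Set.Ioi (0:ℝ), Complex.exp (-(t:ℂ) * (-1 + u * ρ)) *
        Complex.exp (-z * Complex.log (-(-1 + u * ρ))) * k (-(-1 + u * ρ)) * ρ) =
      -∫ u in Set.Ioi (0:ℝ), Complex.exp (t * (1 + u * (-ρ))) *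
        Complex.exp (-z * Complex.log (1 + u * (-ρ))) * (-ρ) * k (1 + u * (-ρ)) := by
    intro ρ
    rw [← integral_neg]
    congr 1
    ext u
    rw [show -(-1 + (u:ℂ) * ρ) = 1 + u * (-ρ) by ring,
      show -(t:ℂ) * (-1 + u * ρ) = t * (1 + u * (-ρ)) by ring]
    ring
  rw [contourIntegral, e, e, ωp, ωm]
  ring

theorem contour_integral_formulas (t : ℝ) (ht : 0 < t) (n : ℕ) (hn : 1 ≤ n) :
    contourIntegral (fun lam =>
        Complex.exp (-(t:ℂ) * lam) * Complex.exp (-((n:ℂ)/2) * Complex.log (-lam)))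
      = (2 * (Real.pi : ℂ) * Complex.I / Complex.Gamma ((n:ℂ)/2)) * (t:ℂ)^((n:ℂ)/2 - 1) ∧
    contourIntegral (fun lam =>
        Complex.exp (-(t:ℂ) * lam) * Complex.exp (-((n:ℂ)/2) * Complex.log (-lam))
          * Complex.log (Complex.exp ((1/2 : ℂ) * Complex.log (-lam))))
      = -((Real.pi : ℂ) * Complex.I / Complex.Gamma ((n:ℂ)/2)) * (t:ℂ)^((n:ℂ)/2 - 1)
            * ((Real.log t : ℝ) : ℂ)
        + ((Real.pi : ℂ) * Complex.I * deriv Complex.Gamma ((n:ℂ)/2)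
            / (Complex.Gamma ((n:ℂ)/2))^2) * (t:ℂ)^((n:ℂ)/2 - 1) := by
  have htc : (t:ℂ) ≠ 0 := by simp [ht.ne']
  have hre : 0 < ((n:ℂ)/2).re := by
    have : (0:ℝ) < n := by exact_mod_cast hn
    simp
    positivity
  generalize hz : (n:ℂ)/2 = z at *
  have hG0 : Complex.Gamma z ≠ 0 := Complex.Gamma_ne_zero_of_re_pos hre
  have hGd : DifferentiableAt ℂ Complex.Gamma z := by
    apply Complex.differentiableAt_Gamma
    intro m hm
    rw [hm] at hre
    simp at hre
    have : (0:ℝ) ≤ m := m.cast_nonneg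
    linarith
  constructor
  · have h1 := contour_eq t z (fun _ => 1)
    simp only [mul_one] at h1
    rw [h1]
    have := congrFun (hankel t ht) z
    simp only [rayInt] at this
    rw [this]
    field_simp
  · have hl : ∀ w : ℂ, Complex.log (Complex.exp ((1/2 : ℂ) * Complex.log w)) =
        (-1/2 : ℂ) * -Complex.log w := by
      intro w
      have him : ((1/2 : ℂ) * Complex.log w).im = Complex.arg w / 2 := by
        rw [show (1/2 : ℂ) = ((1/2 : ℝ) : ℂ) by push_cast; rfl, Complex.im_ofReal_mul, Complex.log_im]
        ring
      have h1 := Complex.neg_pi_lt_arg w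
      have h2 := Complex.arg_le_pi w
      have := Real.pi_pos
      rw [Complex.log_exp]
      · ring
      · rw [him]; linarith
      · rw [him]; linarith
    simp only [hl]
    rw [contour_eq t z (fun w => (-1/2 : ℂ) * -Complex.log w)]
    simp only [mul_left_comm _ (-1/2 : ℂ), integral_const_mul]
    rw [← mul_sub]
    have d1 := (rayInt_hasDerivAt t ht dir_m z).sub (rayInt_hasDerivAt t ht dir_p z)
    have d1' : HasDerivAt (fun z => rayInt t ωm z - rayInt t ωp z) _ z := d1
    rw [hankel t ht] at d1'
    have h1 : HasDerivAt (fun z : ℂ => (t:ℂ) ^ (z - 1)) ((t:ℂ) ^ (z - 1) * Complex.log t * 1) z :=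
      ((hasDerivAt_id z).sub_const 1).const_cpow (Or.inl htc)
    have d2 := (h1.const_mul (2 * (Real.pi : ℂ) * Complex.I)).mul (hGd.hasDerivAt.inv hG0)
    rw [d1'.unique d2, ← Complex.ofReal_log ht.le]
    simp only [Pi.inv_apply]
    field_simp
    ring
end
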